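/- (Failure of the topological Tverberg conjecture for non prime powers.) Let r ≥ 2 be an integer that is not a prime power and let d be an integer with d ≥ 2r+1. Then there exists a continuous map f from the standard simplex Δ_{(d+1)(r−1)} = stdSimplex ℝ (Fin ((d+1)*(r−1)+1)) to EuclideanSpace ℝ (Fin d) such that for every r pairwise disjoint subsets A₁, …, A_r ⊆ Fin ((d+1)*(r−1)+1) the images under f of the faces spanned by A₁, …, A_r have no common point: the intersection over s of f '' {x : ∀ i ∉ A_s, x i = 0} is empty. -/

import Mathlib

open Set Topology

/-- A map `z` with two auxiliary functions `t`, `u` and a set `T` of admissible `r`-tuples. -/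
structure FibreData (r : ℕ) (K Z : Type*) [TopologicalSpace K] [TopologicalSpace Z] where
  z : C(K, Z)
  t : C(K, ℝ)
  u : C(K, ℝ)
  T : Set (Fin r → K)

namespace FibreData

variable {r : ℕ} {K Z : Type*} [TopologicalSpace K] [TopologicalSpace Z]

/-- The admissible tuple `S` lies over `p`, and `t + c * u + h * 1_I` is constantly `b` on it. -/
structure Level (D : FibreData r K Z) (p : Z) (S : Fin r → K) (I : Finset (Fin r))
    (c h b : ℝ) : Prop where
  mem : S ∈ D.T
  fib : ∀ j, D.z (S j) = p
  eq : ∀ j, D.t (S j) + c * D.u (S j) + (if j ∈ I then h else 0) = b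

/-- General position properties of the levels. -/
structure Generic (D : FibreData r K Z) : Prop where
  three_le : 3 ≤ r
  closed : IsClosed D.T
  perm : ∀ S ∈ D.T, ∀ σ : Equiv.Perm (Fin r), S ∘ σ ∈ D.T
  inj : ∀ S ∈ D.T, Function.Injective S
  slope_unique : ∀ {p S I c h b S' I' c' h' b'},
    D.Level p S I c h b → D.Level p S' I' c' h' b' → c = c'
  extra_level : ∀ {p S I h b y}, D.Level p S I 0 h b → D.z y = p → y ∉ range S →
    D.t y ≠ b ∧ D.t y ≠ b - h ∧ ∀ k : ℕ, D.t y ≠ b - 1 / ((k : ℝ) + 1)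
  extra_zero : ∀ {p S I b y}, D.Level p S I 0 0 b → D.z y = p → y ∈ range S
  extra_unique : ∀ {p S I h b y y'}, D.Level p S I 0 h b → D.z y = p → D.z y' = p →
    y ∉ range S → y' ∉ range S → y = y'
  zero_nondegenerate : ∀ {p S I b}, D.Level p S I 0 0 b → ∀ j,
    (S j, S j) ∉ closure {x : K × K | x.1 ≠ x.2 ∧ D.z x.1 = D.z x.2}
  zero_u_inj : ∀ {p S I b}, D.Level p S I 0 0 b → Function.Injective (D.u ∘ S)

variable {D : FibreData r K Z}

theorem Level.perm (hD : D.Generic) {p S I c h b} (H : D.Level p S I c h b)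
    (σ : Equiv.Perm (Fin r)) : D.Level p (S ∘ σ) (I.map σ.symm.toEmbedding) c h b where
  mem := hD.perm S H.mem σ
  fib j := H.fib _
  eq j := by
    have := H.eq (σ j)
    have h2 : j ∈ I.map σ.symm.toEmbedding ↔ σ j ∈ I := by
      simp [Finset.mem_map_equiv]
    simpa [h2] using this

theorem Level.eq_of_mem {p S I c h b} (H : D.Level p S I c h b) {j} (hj : j ∈ I) :
    D.t (S j) + c * D.u (S j) = b - h := by
  have := H.eq j
  rw [if_pos hj] at this; linarith

theorem Level.eq_of_notMem {p S I c h b} (H : D.Level p S I c h b) {j} (hj : j ∉ I) :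
    D.t (S j) + c * D.u (S j) = b := by
  have := H.eq j
  rw [if_neg hj] at this; linarith

/-- A subset of the index set is proper if it is neither empty nor everything. -/
def _root_.Finset.Proper {r : ℕ} (I : Finset (Fin r)) : Prop := I.Nonempty ∧ I ≠ Finset.univ

theorem _root_.Finset.Proper.exists_notMem {r : ℕ} {I : Finset (Fin r)} (h : I.Proper) :
    ∃ j, j ∉ I := by
  by_contra! hc
  exact h.2 (Finset.eq_univ_iff_forall.2 hc)

/-- Two proper levels with the same points have equal gaps and heights. -/
theorem Level.eq_of_range_eq {p S I c h b S' I' h' b'} (H : D.Level p S I c h b)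
    (H' : D.Level p S' I' c h' b') (hI : I.Proper) (hI' : I'.Proper) (hh : 0 ≤ h) (hh' : 0 ≤ h')
    (hr : range S = range S') : b = b' ∧ h = h' := by
  have key : ∀ {S I h b S' I' h' b'}, D.Level p S I c h b → D.Level p S' I' c h' b' →
      I.Proper → 0 ≤ h → 0 ≤ h' → range S = range S' → b ≤ b' ∧ b' - h' ≤ b - h := by
    intro S I h b S' I' h' b' H H' hI hh hh' hr
    have hv : ∀ j, D.t (S j) + c * D.u (S j) ≤ b' ∧ b' - h' ≤ D.t (S j) + c * D.u (S j) := by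
      intro j
      obtain ⟨k, hk⟩ : S j ∈ range S' := hr ▸ mem_range_self j
      rw [← hk]
      by_cases hk : k ∈ I'
      · rw [H'.eq_of_mem hk]; constructor <;> linarith
      · rw [H'.eq_of_notMem hk]; constructor <;> linarith
    obtain ⟨j, hj⟩ := hI.exists_notMem
    obtain ⟨k, hk⟩ := hI.1
    have h1 := hv j
    have h2 := hv k
    rw [H.eq_of_notMem hj] at h1
    rw [H.eq_of_mem hk] at h2
    exact ⟨h1.1, h2.2⟩
  have h1 := key H H' hI hh hh' hr
  have h2 := key H' H hI' hh' hh hr.symm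
  constructor <;> linarith [h1.1, h1.2, h2.1, h2.2]

theorem Level.mem_iff_of_eq {p S I c h b S' I' } (H : D.Level p S I c h b)
    (H' : D.Level p S' I' c h b) (hh : 0 < h) {i j} (hij : S i = S' j) : i ∈ I ↔ j ∈ I' := by
  have h1 := H.eq i
  have h2 := H'.eq j
  rw [hij] at h1
  by_cases hi : i ∈ I <;> by_cases hj : j ∈ I' <;> simp only [hi, hj, if_true, if_false] at h1 h2 ⊢ <;>
    linarith

theorem Level.card_eq_of_range_eq (hD : D.Generic) {p S I c h b S' I'} (H : D.Level p S I c h b)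
    (H' : D.Level p S' I' c h b) (hh : 0 < h) (hr : range S = range S') : I.card = I'.card := by
  have hS := hD.inj S H.mem
  have hS' := hD.inj S' H'.mem
  have key : ∀ j, ∃ k, S' k = S j := fun j => by
    have : S j ∈ range S' := hr ▸ mem_range_self j
    exact this
  choose f hf using key
  have hfi : Function.Injective f := fun i j hij => hS (by rw [← hf, ← hf, hij])
  let σ : Equiv.Perm (Fin r) := Equiv.ofBijective f (Finite.injective_iff_bijective.1 hfi)
  have : I.map σ.toEmbedding = I' := by
    ext k
    rw [Finset.mem_map_equiv, H.mem_iff_of_eq H' hh (j := k)]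
    rw [← hf]
    exact congrArg S' (σ.apply_symm_apply k)
  rw [← this, Finset.card_map]

/-- Comparison of two levels of slope zero over the same point. -/
theorem Level.compare_zero (hD : D.Generic) {p S I h b S' I' h' b'} (H : D.Level p S I 0 h b)
    (H' : D.Level p S' I' 0 h' b') (hI : I.Proper) (hI' : I'.Proper) (hh : 0 < h) (hh' : 0 < h')
    (hc : 2 * I.card ≤ r) :
    (2 * I'.card ≤ r → I.card = I'.card ∧ b = b') ∧
      (r < 2 * I'.card → ∃ j ∈ I', D.t (S' j) = b) := by
  have hS := hD.inj S H.mem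
  have hS' := hD.inj S' H'.mem
  have e1 : ∀ {j}, j ∈ I → D.t (S j) = b - h := fun hj => by simpa using H.eq_of_mem hj
  have e2 : ∀ {j}, j ∉ I → D.t (S j) = b := fun hj => by simpa using H.eq_of_notMem hj
  have e1' : ∀ {j}, j ∈ I' → D.t (S' j) = b' - h' := fun hj => by simpa using H'.eq_of_mem hj
  have e2' : ∀ {j}, j ∉ I' → D.t (S' j) = b' := fun hj => by simpa using H'.eq_of_notMem hj
  have e3 : ∀ j, D.t (S j) = b ∨ D.t (S j) = b - h := fun j => by
    by_cases hj : j ∈ I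
    · exact Or.inr (e1 hj)
    · exact Or.inl (e2 hj)
  have e3' : ∀ j, D.t (S' j) = b' ∨ D.t (S' j) = b' - h' := fun j => by
    by_cases hj : j ∈ I'
    · exact Or.inr (e1' hj)
    · exact Or.inl (e2' hj)
  by_cases hr : range S = range S'
  · obtain ⟨hb, hhh⟩ := H.eq_of_range_eq H' hI hI' hh.le hh'.le hr
    subst hb; subst hhh
    have := H.card_eq_of_range_eq hD H' hh hr
    exact ⟨fun _ => ⟨this, rfl⟩, fun h => by omega⟩
  -- exactly one point is exchanged
  obtain ⟨k, hk⟩ : ∃ k, S' k ∉ range S := by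
    by_contra! hcon
    refine hr (Set.Subset.antisymm ?_ (by rintro _ ⟨j, rfl⟩; exact hcon j))
    choose f hf using hcon
    have hfi : Function.Injective f := fun i j hij => hS' (by rw [← hf, ← hf, hij])
    rintro _ ⟨j, rfl⟩
    obtain ⟨i, rfl⟩ := (Finite.injective_iff_surjective.1 hfi) j
    exact ⟨i, (hf i).symm⟩
  obtain ⟨l, hl⟩ : ∃ l, S l ∉ range S' := by
    by_contra! hcon
    refine hr (Set.Subset.antisymm (by rintro _ ⟨j, rfl⟩; exact hcon j) ?_)
    choose f hf using hcon
    have hfi : Function.Injective f := fun i j hij => hS (by rw [← hf, ← hf, hij])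
    rintro _ ⟨j, rfl⟩
    obtain ⟨i, rfl⟩ := (Finite.injective_iff_surjective.1 hfi) j
    exact ⟨i, (hf i).symm⟩
  have hk' : ∀ i, i ≠ k → S' i ∈ range S := fun i hi => by
    by_contra hcon
    exact hi (hS' (hD.extra_unique H (H'.fib i) (H'.fib k) hcon hk))
  have hl' : ∀ i, i ≠ l → S i ∈ range S' := fun i hi => by
    by_contra hcon
    exact hi (hS (hD.extra_unique H' (H.fib i) (H.fib l) hcon hl))
  obtain ⟨hk1, hk2, -⟩ := hD.extra_level H (H'.fib k) hk
  obtain ⟨hl1, hl2, -⟩ := hD.extra_level H' (H.fib l) hl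
  -- the value on the exchanged point differs from all other values
  have hne : ∀ i, i ≠ k → D.t (S' i) ≠ D.t (S' k) := fun i hi => by
    obtain ⟨j, hj⟩ := hk' i hi
    rw [← hj]
    rcases e3 j with h | h <;> rw [h] <;> exact Ne.symm ‹_›
  have hne' : ∀ i, i ≠ l → D.t (S i) ≠ D.t (S l) := fun i hi => by
    obtain ⟨j, hj⟩ := hl' i hi
    rw [← hj]
    rcases e3' j with h | h <;> rw [h] <;> exact Ne.symm ‹_›
  have h3 := hD.three_le
  have card_compl : ∀ (k : Fin r), ({k}ᶜ : Finset (Fin r)).card = r - 1 := fun k => by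
    rw [Finset.card_compl]; simp
  have hIl : I = {l} := by
    by_cases hlI : l ∈ I
    · ext i
      rw [Finset.mem_singleton]
      refine ⟨fun hi => ?_, fun hi => hi ▸ hlI⟩
      by_contra hil
      exact hne' i hil (by rw [e1 hi, e1 hlI])
    · exfalso
      have : I = {l}ᶜ := by
        ext i
        rw [Finset.mem_compl, Finset.mem_singleton]
        refine ⟨fun hi hil => hlI (hil ▸ hi), fun hil => ?_⟩
        by_contra hi
        exact hne' i hil (by rw [e2 hi, e2 hlI])
      rw [this, card_compl] at hc
      omega
  have hcommon : ∀ i, i ≠ k → D.t (S' i) = b := fun i hi => by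
    obtain ⟨j, hj⟩ := hk' i hi
    rw [← hj]
    apply e2
    rw [hIl, Finset.mem_singleton]
    rintro rfl
    exact hl (hj ▸ mem_range_self i)
  obtain ⟨i, hi⟩ : ∃ i, i ≠ k := by
    have : Nontrivial (Fin r) := Fin.nontrivial_iff_two_le.2 (by omega)
    exact exists_ne k
  by_cases hkI : k ∈ I'
  · have : I' = {k} := by
      ext i
      rw [Finset.mem_singleton]
      refine ⟨fun hi => ?_, fun hi => hi ▸ hkI⟩
      by_contra hil
      exact hne i hil (by rw [e1' hi, e1' hkI])
    refine ⟨fun _ => ⟨by simp [hIl, this], ?_⟩, fun h => ?_⟩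
    · rw [← hcommon i hi, e2']
      rw [this, Finset.mem_singleton]; exact hi
    · rw [this, Finset.card_singleton] at h; omega
  · have : I' = {k}ᶜ := by
      ext i
      rw [Finset.mem_compl, Finset.mem_singleton]
      refine ⟨fun hi hil => hkI (hil ▸ hi), fun hil => ?_⟩
      by_contra hi
      exact hne i hil (by rw [e2' hi, e2' hkI])
    refine ⟨fun h => ?_, fun _ => ⟨i, by simp [this, hi], hcommon i hi⟩⟩
    rw [this, card_compl] at h; omega

end FibreData

theorem IsCompact.eventually_forall_lt {X : Type*} [TopologicalSpace X] {Q : Set X}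
    (hQ : IsCompact Q) {f : X → ℝ} (hf : Continuous f) (hpos : ∀ x ∈ Q, 0 < f x) :
    ∀ᶠ δ : ℝ in 𝓝[>] 0, ∀ x ∈ Q, δ < f x := by
  rcases Q.eq_empty_or_nonempty with rfl | hne
  · simp
  obtain ⟨x, hx, hmin⟩ := hQ.exists_isMinOn hne hf.continuousOn
  filter_upwards [Ioo_mem_nhdsGT (hpos x hx)] with δ hδ y hy
  exact hδ.2.trans_le (hmin hy)

namespace FibreData

variable {r : ℕ} {K Z : Type*} [TopologicalSpace K] [TopologicalSpace Z]

/-- Levels with slope at most one and gap at most `B`, as a subset of the space of all data. -/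
def levelSet (D : FibreData r K Z) (B : ℝ) (I : Finset (Fin r)) :
    Set (Z × (Fin r → K) × ℝ × ℝ × ℝ) :=
  {x | D.Level x.1 x.2.1 I x.2.2.1 x.2.2.2.1 x.2.2.2.2 ∧ |x.2.2.1| ≤ 1 ∧ 0 ≤ x.2.2.2.1 ∧
    x.2.2.2.1 ≤ B}

variable {D : FibreData r K Z}

theorem exists_abs_le [CompactSpace K] (D : FibreData r K Z) :
    ∃ M, 0 ≤ M ∧ ∀ x, |D.t x| ≤ M ∧ |D.u x| ≤ M := by
  refine ⟨‖D.t‖ + ‖D.u‖, by positivity, fun x => ⟨?_, ?_⟩⟩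
  · exact (D.t.norm_coe_le_norm x).trans (le_add_of_nonneg_right (norm_nonneg _))
  · exact (D.u.norm_coe_le_norm x).trans (le_add_of_nonneg_left (norm_nonneg _))

theorem exists_gap_le [CompactSpace K] (D : FibreData r K Z) :
    ∃ B, 1 ≤ B ∧ ∀ {p S I c h b}, D.Level p S I c h b → I.Proper → |c| ≤ 1 → h ≤ B := by
  obtain ⟨M, hM0, hM⟩ := D.exists_abs_le
  refine ⟨4 * M + 1, by linarith, fun {p S I c h b} H hI hc => ?_⟩
  obtain ⟨j, hj⟩ := hI.exists_notMem
  obtain ⟨k, hk⟩ := hI.1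
  have hv : ∀ x, |D.t x + c * D.u x| ≤ 2 * M := fun x => by
    have : |c * D.u x| ≤ 1 * M := by
      rw [abs_mul]; exact mul_le_mul hc (hM x).2 (abs_nonneg _) zero_le_one
    linarith [abs_add_le (D.t x) (c * D.u x), (hM x).1]
  have h1 := abs_le.1 (hv (S j))
  have h2 := abs_le.1 (hv (S k))
  rw [H.eq_of_notMem hj] at h1
  rw [H.eq_of_mem hk] at h2
  linarith [h1.2, h2.1]

theorem isClosed_level [T2Space Z] (hD : D.Generic) (I : Finset (Fin r)) :
    IsClosed {x : Z × (Fin r → K) × ℝ × ℝ × ℝ |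
      D.Level x.1 x.2.1 I x.2.2.1 x.2.2.2.1 x.2.2.2.2} := by
  have : {x : Z × (Fin r → K) × ℝ × ℝ × ℝ | D.Level x.1 x.2.1 I x.2.2.1 x.2.2.2.1 x.2.2.2.2} =
      {x | x.2.1 ∈ D.T} ∩ ({x | ∀ j, D.z (x.2.1 j) = x.1} ∩
        {x | ∀ j, D.t (x.2.1 j) + x.2.2.1 * D.u (x.2.1 j) +
          (if j ∈ I then x.2.2.2.1 else 0) = x.2.2.2.2}) := by
    ext x
    exact ⟨fun h => ⟨h.1, h.2, h.3⟩, fun h => ⟨h.1, h.2.1, h.2.2⟩⟩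
  rw [this]
  refine (hD.closed.preimage (by fun_prop)).inter (IsClosed.and ?_ ?_)
  · rw [ofPred_forall]
    exact isClosed_iInter fun j => isClosed_eq (by fun_prop) (by fun_prop)
  · rw [ofPred_forall]
    refine isClosed_iInter fun j => isClosed_eq ?_ (by fun_prop)
    split_ifs <;> fun_prop

theorem isCompact_levelSet [CompactSpace K] [T2Space Z] (hD : D.Generic)
    (B : ℝ) (I : Finset (Fin r)) : IsCompact (D.levelSet B I) := by
  obtain ⟨M, hM0, hM⟩ := D.exists_abs_le
  have hr := hD.three_le
  have hcl : IsClosed (D.levelSet B I) := by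
    refine (isClosed_level hD I).and (IsClosed.and ?_ (IsClosed.and ?_ ?_))
    · exact isClosed_le (by fun_prop) (by fun_prop)
    · exact isClosed_le (by fun_prop) (by fun_prop)
    · exact isClosed_le (by fun_prop) (by fun_prop)
  refine IsCompact.of_isClosed_subset (s := range D.z ×ˢ (univ : Set (Fin r → K)) ×ˢ
    Icc (-1 : ℝ) 1 ×ˢ Icc 0 B ×ˢ Icc (-(2 * M + B)) (2 * M + B)) ?_ hcl ?_
  · exact (isCompact_range D.z.continuous).prod (isCompact_univ.prod
      (isCompact_Icc.prod (isCompact_Icc.prod isCompact_Icc)))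
  · rintro ⟨p, S, c, h, b⟩ ⟨H, hc, h0, hB⟩
    dsimp only at H hc h0 hB
    let j : Fin r := ⟨0, by omega⟩
    refine ⟨⟨S j, H.fib j⟩, trivial, abs_le.1 hc, ⟨h0, hB⟩, abs_le.1 ?_⟩
    have h1 := H.eq j
    have h2 := hM (S j)
    have h3 : |c * D.u (S j)| ≤ 1 * M := by
      rw [abs_mul]; exact mul_le_mul hc h2.2 (abs_nonneg _) zero_le_one
    have h4 : |if j ∈ I then h else 0| ≤ B := by
      split_ifs
      · rw [abs_of_nonneg h0]; exact hB
      · simpa using h0.trans hB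
    dsimp only
    rw [← h1]
    calc _ ≤ |D.t (S j)| + |c * D.u (S j)| + |if j ∈ I then h else 0| := abs_add_three _ _ _
      _ ≤ _ := by linarith [h2.1]

/-- Near the zeros, a level exhausts its fibre and `u` separates its points. -/
theorem exists_near [CompactSpace K] [T2Space Z] (hD : D.Generic) :
    ∃ h₁ : ℝ, 0 < h₁ ∧ h₁ ≤ 1 ∧ ∀ {p S I c h b}, D.Level p S I c h b → |c| ≤ h₁ → 0 ≤ h →
      h ≤ h₁ → (∀ y, D.z y = p → y ∈ range S) ∧ Function.Injective (D.u ∘ S) := by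
  have e1 : ∀ I, ∀ᶠ δ : ℝ in 𝓝[>] 0, ∀ x ∈ (D.levelSet 1 I ×ˢ (univ : Set K)) ∩
      {x | D.z x.2 = x.1.1 ∧ ∀ j, (x.2, x.1.2.1 j) ∈
        closure {x : K × K | x.1 ≠ x.2 ∧ D.z x.1 = D.z x.2}},
      δ < |x.1.2.2.1| + |x.1.2.2.2.1| := by
    intro I
    refine IsCompact.eventually_forall_lt ?_ (by fun_prop) ?_
    · refine ((isCompact_levelSet hD 1 I).prod isCompact_univ).inter_right (IsClosed.and ?_ ?_)
      · exact isClosed_eq (by fun_prop) (by fun_prop)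
      · simp only [ofPred_forall]
        exact isClosed_iInter fun j => isClosed_closure.preimage (by fun_prop)
    · rintro ⟨⟨p, S, c, h, b⟩, y⟩ ⟨⟨⟨H, -⟩, -⟩, hy, hcl⟩
      dsimp only at H hy hcl ⊢
      by_contra! hcon
      have hc : c = 0 := abs_eq_zero.1 (by linarith [abs_nonneg c, abs_nonneg h])
      have hh : h = 0 := abs_eq_zero.1 (by linarith [abs_nonneg c, abs_nonneg h])
      subst hc; subst hh
      obtain ⟨j, rfl⟩ := hD.extra_zero H hy
      exact hD.zero_nondegenerate H j (hcl j)
  have e2 : ∀ I, ∀ ij : Fin r × Fin r, ∀ᶠ δ : ℝ in 𝓝[>] 0, ij.1 ≠ ij.2 →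
      ∀ x ∈ D.levelSet 1 I ∩ {x | D.u (x.2.1 ij.1) = D.u (x.2.1 ij.2)},
      δ < |x.2.2.1| + |x.2.2.2.1| := by
    rintro I ⟨i, j⟩
    by_cases hij : i = j
    · simp [hij]
    refine (IsCompact.eventually_forall_lt ?_ (by fun_prop) ?_).mono fun δ h _ => h
    · exact (isCompact_levelSet hD 1 I).inter_right (isClosed_eq (by fun_prop) (by fun_prop))
    · rintro ⟨p, S, c, h, b⟩ ⟨⟨H, -⟩, hu⟩
      dsimp only at H hu ⊢
      by_contra! hcon
      have hc : c = 0 := abs_eq_zero.1 (by linarith [abs_nonneg c, abs_nonneg h])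
      have hh : h = 0 := abs_eq_zero.1 (by linarith [abs_nonneg c, abs_nonneg h])
      subst hc; subst hh
      exact hij (hD.zero_u_inj H hu)
  obtain ⟨δ, ⟨h1, h2⟩, hδ0, hδ1⟩ := (((Filter.eventually_all.2 e1).and
    (Filter.eventually_all.2 fun I => Filter.eventually_all.2 (e2 I))).and
      (Ioo_mem_nhdsGT (show (0 : ℝ) < 1 by norm_num))).exists
  refine ⟨δ / 2, by linarith, by linarith, fun {p S I c h b} H hc h0 hh => ?_⟩
  have hx : (p, S, c, h, b) ∈ D.levelSet 1 I :=
    ⟨H, show |c| ≤ 1 by linarith, h0, show h ≤ 1 by linarith⟩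
  constructor
  · intro y hy
    by_contra hyS
    have := h1 I ((p, S, c, h, b), y) ⟨⟨hx, trivial⟩, hy, fun j => subset_closure
      ⟨fun h => hyS ⟨j, h.symm⟩, by rw [hy]; exact (H.fib j).symm⟩⟩
    dsimp only at this
    rw [abs_of_nonneg h0] at this
    linarith
  · intro i j hij
    by_contra hne
    have := h2 I (i, j) hne (p, S, c, h, b) ⟨hx, hij⟩
    dsimp only at this
    rw [abs_of_nonneg h0] at this
    linarith

/-- Far from the zeros, the small levels of small slope over a point are compatible. -/
theorem exists_far [CompactSpace K] [T2Space Z] (hD : D.Generic) {h₁ : ℝ} {k : ℕ}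
    (hk : 1 / ((k : ℝ) + 1) < h₁) :
    ∃ ε : ℝ, 0 < ε ∧ ε ≤ h₁ ∧ ∀ {p S I c h b S' I' h' b'}, D.Level p S I c h b →
      D.Level p S' I' c h' b' → I.Proper → I'.Proper → |c| ≤ ε → |c| ≤ 1 → h₁ ≤ h → h₁ ≤ h' →
      2 * I.card ≤ r →
      (2 * I'.card ≤ r → I.card = I'.card ∧ ∀ y, D.z y = p →
        ¬ (D.t y + c * D.u y ≤ b - 1 / ((k : ℝ) + 1) ∧
          b' - 1 / ((k : ℝ) + 1) ≤ D.t y + c * D.u y)) ∧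
      (r < 2 * I'.card → ∃ j ∈ I', b - 1 / ((k : ℝ) + 1) < D.t (S' j) + c * D.u (S' j)) := by
  set θ : ℝ := 1 / ((k : ℝ) + 1) with hθ
  have hθ0 : 0 < θ := by positivity
  obtain ⟨B, hB1, hB⟩ := D.exists_gap_le
  let Q (I I' : Finset (Fin r)) := (D.levelSet B I ×ˢ D.levelSet B I') ∩
    {x | x.1.1 = x.2.1 ∧ x.1.2.2.1 = x.2.2.2.1 ∧ h₁ ≤ x.1.2.2.2.1 ∧ h₁ ≤ x.2.2.2.2.1}
  have hQ : ∀ I I', IsCompact (Q I I') := fun I I' => by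
    refine ((isCompact_levelSet hD B I).prod (isCompact_levelSet hD B I')).inter_right
      (IsClosed.and ?_ (IsClosed.and ?_ (IsClosed.and ?_ ?_)))
    · exact isClosed_eq (by fun_prop) (by fun_prop)
    · exact isClosed_eq (by fun_prop) (by fun_prop)
    · exact isClosed_le (by fun_prop) (by fun_prop)
    · exact isClosed_le (by fun_prop) (by fun_prop)
  have hpos : 0 < h₁ := hθ0.trans hk
  have e1 : ∀ I I', ∀ᶠ δ : ℝ in 𝓝[>] 0, I.Proper → I'.Proper → 2 * I.card ≤ r →
      2 * I'.card ≤ r → I.card ≠ I'.card → ∀ x ∈ Q I I', δ < |x.1.2.2.1| := by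
    intro I I'
    by_cases hyp : I.Proper ∧ I'.Proper ∧ 2 * I.card ≤ r ∧ 2 * I'.card ≤ r ∧ I.card ≠ I'.card
    swap
    · exact Filter.Eventually.of_forall fun δ a b c d e => absurd ⟨a, b, c, d, e⟩ hyp
    obtain ⟨hI, hI', hc, hc', hne⟩ := hyp
    refine ((hQ I I').eventually_forall_lt (by fun_prop) ?_).mono fun δ h _ _ _ _ _ => h
    rintro ⟨⟨p, S, c, h, b⟩, ⟨p', S', c', h', b'⟩⟩ ⟨⟨⟨H, -⟩, ⟨H', -⟩⟩, hp, hcc, hh, hh'⟩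
    dsimp only at H H' hp hcc hh hh' ⊢
    subst hp; subst hcc
    by_contra! hcon
    have hc0 := abs_nonpos_iff.1 hcon
    subst hc0
    exact hne ((H.compare_zero hD H' hI hI' (hpos.trans_le hh) (hpos.trans_le hh') hc).1 hc').1
  have e2 : ∀ I I', ∀ᶠ δ : ℝ in 𝓝[>] 0, I.Proper → I'.Proper → 2 * I.card ≤ r →
      2 * I'.card ≤ r → ∀ x ∈ (Q I I' ×ˢ (univ : Set K)) ∩
        {x | D.z x.2 = x.1.1.1 ∧
          D.t x.2 + x.1.1.2.2.1 * D.u x.2 ≤ x.1.1.2.2.2.2 - θ ∧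
          x.1.2.2.2.2.2 - θ ≤ D.t x.2 + x.1.1.2.2.1 * D.u x.2},
      δ < |x.1.1.2.2.1| := by
    intro I I'
    by_cases hyp : I.Proper ∧ I'.Proper ∧ 2 * I.card ≤ r ∧ 2 * I'.card ≤ r
    swap
    · exact Filter.Eventually.of_forall fun δ a b c d => absurd ⟨a, b, c, d⟩ hyp
    obtain ⟨hI, hI', hc, hc'⟩ := hyp
    refine ((((hQ I I').prod isCompact_univ).inter_right
      (IsClosed.and ?_ (IsClosed.and ?_ ?_))).eventually_forall_lt (by fun_prop) ?_).mono
        fun δ h _ _ _ _ => h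
    · exact isClosed_eq (by fun_prop) (by fun_prop)
    · exact isClosed_le (by fun_prop) (by fun_prop)
    · exact isClosed_le (by fun_prop) (by fun_prop)
    rintro ⟨⟨⟨p, S, c, h, b⟩, ⟨p', S', c', h', b'⟩⟩, y⟩
      ⟨⟨⟨⟨⟨H, -⟩, ⟨H', -⟩⟩, hp, hcc, hh, hh'⟩, -⟩, hy, hy1, hy2⟩
    dsimp only at H H' hp hcc hh hh' hy hy1 hy2 ⊢
    subst hp; subst hcc
    by_contra! hcon
    have hc0 := abs_nonpos_iff.1 hcon
    subst hc0
    obtain ⟨-, rfl⟩ :=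
      (H.compare_zero hD H' hI hI' (hpos.trans_le hh) (hpos.trans_le hh') hc).1 hc'
    have hyb : D.t y = b - θ := by linarith
    by_cases hyS : y ∈ range S
    · obtain ⟨j, rfl⟩ := hyS
      by_cases hj : j ∈ I
      · have := H.eq_of_mem hj; linarith
      · have := H.eq_of_notMem hj; linarith
    · exact (hD.extra_level H hy hyS).2.2 k hyb
  have e3 : ∀ I I', ∀ᶠ δ : ℝ in 𝓝[>] 0, I.Proper → I'.Proper → 2 * I.card ≤ r →
      r < 2 * I'.card → ∀ x ∈ Q I I' ∩
        {x | ∀ j ∈ I', D.t (x.2.2.1 j) + x.1.2.2.1 * D.u (x.2.2.1 j) ≤ x.1.2.2.2.2 - θ},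
      δ < |x.1.2.2.1| := by
    intro I I'
    by_cases hyp : I.Proper ∧ I'.Proper ∧ 2 * I.card ≤ r ∧ r < 2 * I'.card
    swap
    · exact Filter.Eventually.of_forall fun δ a b c d => absurd ⟨a, b, c, d⟩ hyp
    obtain ⟨hI, hI', hc, hc'⟩ := hyp
    refine (((hQ I I').inter_right ?_).eventually_forall_lt (by fun_prop) ?_).mono
        fun δ h _ _ _ _ => h
    · simp only [ofPred_forall]
      exact isClosed_iInter fun j => isClosed_iInter fun _ =>
        isClosed_le (by fun_prop) (by fun_prop)
    rintro ⟨⟨p, S, c, h, b⟩, ⟨p', S', c', h', b'⟩⟩ ⟨⟨⟨⟨H, -⟩, ⟨H', -⟩⟩, hp, hcc, hh, hh'⟩, hj⟩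
    dsimp only [mem_ofPred_eq] at H H' hp hcc hh hh' hj ⊢
    subst hp; subst hcc
    by_contra! hcon
    have hc0 := abs_nonpos_iff.1 hcon
    subst hc0
    obtain ⟨j, hj', hjb⟩ :=
      (H.compare_zero hD H' hI hI' (hpos.trans_le hh) (hpos.trans_le hh') hc).2 hc'
    have := hj j hj'
    linarith
  obtain ⟨ε, ⟨⟨h1, h2⟩, h3⟩, hε0, hε1⟩ := ((((Filter.eventually_all.2 fun I =>
    Filter.eventually_all.2 (e1 I)).and (Filter.eventually_all.2 fun I =>
    Filter.eventually_all.2 (e2 I))).and (Filter.eventually_all.2 fun I =>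
    Filter.eventually_all.2 (e3 I))).and (Ioo_mem_nhdsGT hpos)).exists
  refine ⟨ε, hε0, hε1.le, ?_⟩
  intro p S I c h b S' I' h' b' H H' hI hI' hc hc1 hh hh' hcard
  have hx : ((p, S, c, h, b), (p, S', c, h', b')) ∈ Q I I' :=
    ⟨⟨⟨H, hc1, hpos.le.trans hh, hB H hI hc1⟩, ⟨H', hc1, hpos.le.trans hh', hB H' hI' hc1⟩⟩,
      rfl, rfl, hh, hh'⟩
  refine ⟨fun hcard' => ⟨?_, fun y hy hyy => ?_⟩, fun hcard' => ?_⟩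
  · by_contra hne
    exact absurd (h1 I I' hI hI' hcard hcard' hne _ hx) hc.not_gt
  · exact absurd (h2 I I' hI hI' hcard hcard' (_, y) ⟨⟨hx, trivial⟩, hy, hyy⟩) hc.not_gt
  · by_contra! hcon
    exact absurd (h3 I I' hI hI' hcard hcard' _ ⟨hx, hcon⟩) hc.not_gt

end FibreData

/-- A function prescribed on a finite family of compact sets, constant on the fibres of the
projection, descends and extends to a continuous function on the base. -/
theorem exists_descend_extend {ι X Z : Type*} [Finite ι] [TopologicalSpace X]
    [TopologicalSpace Z] [T2Space Z] [NormalSpace Z] (D : ι → Set X) (hD : ∀ i, IsCompact (D i))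
    {π : X → Z} (hπ : Continuous π) {v : ι → X → ℝ} (hv : ∀ i, Continuous (v i)) {s : Set ℝ}
    [hs : OrdConnected s] (hne : s.Nonempty) (hvs : ∀ i, ∀ x ∈ D i, v i x ∈ s)
    (hc : ∀ i j, ∀ x ∈ D i, ∀ y ∈ D j, π x = π y → v i x = v j y) :
    ∃ f : C(Z, ℝ), (∀ p, f p ∈ s) ∧ ∀ i, ∀ x ∈ D i, f (π x) = v i x := by
  have : ∀ i, CompactSpace (D i) := fun i => isCompact_iff_compactSpace.1 (hD i)
  let q : (Σ i, D i) → Z := fun x => π x.2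
  have hq : Continuous q := by
    refine continuous_sigma fun i => ?_
    exact hπ.comp continuous_subtype_val
  let w : C((Σ i, D i), ℝ) := ⟨fun x => v x.1 x.2, by
    refine continuous_sigma fun i => ?_
    exact (hv i).comp continuous_subtype_val⟩
  let q' : C((Σ i, D i), range q) := ⟨rangeFactorization q, hq.subtype_mk _⟩
  have hq' : IsQuotientMap q' :=
    q'.continuous.isClosedMap.isQuotientMap q'.continuous rangeFactorization_surjective
  have hw : Function.FactorsThrough w q' := by
    rintro ⟨i, x⟩ ⟨j, y⟩ hxy
    exact hc i j x x.2 y y.2 (congrArg Subtype.val hxy)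
  have hl : ∀ x, hq'.lift w hw (q' x) = w x := fun x =>
    DFunLike.congr_fun (hq'.lift_comp w hw) x
  obtain ⟨f, hf, hfe⟩ := ContinuousMap.exists_restrict_eq_forall_mem_of_closed
    (hq'.lift w hw) (t := s) (by
      rintro ⟨_, x, rfl⟩
      rw [show (⟨q x, x, rfl⟩ : range q) = q' x from rfl, hl]
      exact hvs _ _ x.2.2) hne (isCompact_range hq).isClosed
  refine ⟨f, hf, fun i x hx => ?_⟩
  have := DFunLike.congr_fun hfe (q' ⟨i, x, hx⟩)
  rw [hl] at this
  exact this

namespace FibreData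

variable {r : ℕ} {K Z : Type*} [TopologicalSpace K] [TopologicalSpace Z]

/-- Constants separating the levels near the zeros from those far from the zeros. -/
structure Scale (D : FibreData r K Z) where
  B : ℝ
  h₁ : ℝ
  ε : ℝ
  θ : ℝ
  one_le_B : 1 ≤ B
  gap_le : ∀ {p S I c h b}, D.Level p S I c h b → I.Proper → |c| ≤ 1 → h ≤ B
  h₁_pos : 0 < h₁
  h₁_le_one : h₁ ≤ 1
  ε_pos : 0 < ε
  ε_le : ε ≤ h₁
  θ_pos : 0 < θ
  θ_lt : θ < h₁
  near : ∀ {p S I c h b}, D.Level p S I c h b → |c| ≤ h₁ → 0 ≤ h → h ≤ h₁ →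
    (∀ y, D.z y = p → y ∈ range S) ∧ Function.Injective (D.u ∘ S)
  far : ∀ {p S I c h b S' I' h' b'}, D.Level p S I c h b →
      D.Level p S' I' c h' b' → I.Proper → I'.Proper → |c| ≤ ε → |c| ≤ 1 → h₁ ≤ h → h₁ ≤ h' →
      2 * I.card ≤ r →
      (2 * I'.card ≤ r → I.card = I'.card ∧ ∀ y, D.z y = p →
        ¬ (D.t y + c * D.u y ≤ b - θ ∧ b' - θ ≤ D.t y + c * D.u y)) ∧
      (r < 2 * I'.card → ∃ j ∈ I', b - θ < D.t (S' j) + c * D.u (S' j))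

variable {D : FibreData r K Z}

theorem Generic.nonempty_scale [CompactSpace K] [T2Space Z] (hD : D.Generic) :
    Nonempty D.Scale := by
  obtain ⟨B, hB, gap⟩ := D.exists_gap_le
  obtain ⟨h₁, h0, h1, near⟩ := exists_near hD
  obtain ⟨k, hk⟩ := exists_nat_one_div_lt h0
  obtain ⟨ε, hε, hε1, far⟩ := exists_far hD hk
  exact ⟨⟨B, h₁, ε, 1 / ((k : ℝ) + 1), hB, gap, h0, h1, hε, hε1, by positivity, hk, near, far⟩⟩

theorem Level.range_eq_of_exhausts (hD : D.Generic) {p I' c' h' b'}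
    {S S' : Fin r → K}
    (H' : D.Level p S' I' c' h' b')
    (hex : ∀ y, D.z y = p → y ∈ range S) : range S = range S' := by
  have hS' := hD.inj S' H'.mem
  have key : ∀ j, ∃ k, S k = S' j := fun j => hex _ (H'.fib j)
  choose f hf using key
  have hfi : Function.Injective f := fun i j hij => hS' (by rw [← hf, ← hf, hij])
  apply Set.Subset.antisymm
  · rintro _ ⟨j, rfl⟩
    obtain ⟨i, rfl⟩ := (Finite.injective_iff_surjective.1 hfi) j
    exact ⟨i, (hf i).symm⟩
  · rintro _ ⟨j, rfl⟩
    exact hex _ (H'.fib j)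

namespace Scale

variable (X : D.Scale)

/-- Sorted levels close to the zeros. -/
structure Near (p : Z) (S : Fin r → K) (I : Finset (Fin r)) (c h b : ℝ) : Prop where
  level : D.Level p S I c h b
  proper : I.Proper
  slope : |c| ≤ X.ε
  nonneg : 0 ≤ h
  le : h ≤ X.h₁
  mono : Monotone (D.u ∘ S)

/-- Levels far from the zeros. -/
structure Far (p : Z) (S : Fin r → K) (I : Finset (Fin r)) (c h b : ℝ) : Prop where
  level : D.Level p S I c h b
  proper : I.Proper
  slope : |c| ≤ X.ε
  le : X.h₁ ≤ h

variable {X}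

theorem ε_le_one (X : D.Scale) : X.ε ≤ 1 := X.ε_le.trans X.h₁_le_one

theorem Far.pos {p S I c h b} (H : X.Far p S I c h b) : 0 < h := X.h₁_pos.trans_le H.le

theorem isCompact_near [CompactSpace K] [T2Space Z] (hD : D.Generic) (X : D.Scale) (I) :
    IsCompact {x : Z × (Fin r → K) × ℝ × ℝ × ℝ |
      X.Near x.1 x.2.1 I x.2.2.1 x.2.2.2.1 x.2.2.2.2} := by
  by_cases hI : I.Proper
  · have h2 : IsClosed {x : Z × (Fin r → K) × ℝ × ℝ × ℝ |
        |x.2.2.1| ≤ X.ε ∧ x.2.2.2.1 ≤ X.h₁ ∧ ∀ i j, i ≤ j → D.u (x.2.1 i) ≤ D.u (x.2.1 j)} := by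
      refine IsClosed.and ?_ (IsClosed.and ?_ ?_)
      · exact isClosed_le (by fun_prop) (by fun_prop)
      · exact isClosed_le (by fun_prop) (by fun_prop)
      · simp only [ofPred_forall]
        exact isClosed_iInter fun i => isClosed_iInter fun j => isClosed_iInter fun _ =>
          isClosed_le (by fun_prop) (by fun_prop)
    convert (isCompact_levelSet hD X.B I).inter_right h2 using 1
    ext ⟨p, S, c, h, b⟩
    constructor
    · intro H
      exact ⟨⟨H.level, H.slope.trans X.ε_le_one, H.nonneg,
        H.le.trans (X.h₁_le_one.trans X.one_le_B)⟩, H.slope, H.le, fun i j hij => H.mono hij⟩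
    · rintro ⟨⟨H, -, h0, -⟩, hc, hh, hm⟩
      exact ⟨H, hI, hc, h0, hh, hm⟩
  · convert isCompact_empty
    ext x
    exact ⟨fun H => hI H.proper, fun H => H.elim⟩

theorem isCompact_far [CompactSpace K] [T2Space Z] (hD : D.Generic) (X : D.Scale) (I) :
    IsCompact {x : Z × (Fin r → K) × ℝ × ℝ × ℝ |
      X.Far x.1 x.2.1 I x.2.2.1 x.2.2.2.1 x.2.2.2.2} := by
  by_cases hI : I.Proper
  · have h2 : IsClosed {x : Z × (Fin r → K) × ℝ × ℝ × ℝ |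
        |x.2.2.1| ≤ X.ε ∧ X.h₁ ≤ x.2.2.2.1} := by
      refine IsClosed.and ?_ ?_
      · exact isClosed_le (by fun_prop) (by fun_prop)
      · exact isClosed_le (by fun_prop) (by fun_prop)
    convert (isCompact_levelSet hD X.B I).inter_right h2 using 1
    ext ⟨p, S, c, h, b⟩
    constructor
    · intro H
      have hc := H.slope.trans X.ε_le_one
      exact ⟨⟨H.level, hc, H.pos.le, X.gap_le H.level H.proper hc⟩, H.slope, H.le⟩
    · rintro ⟨⟨H, -, h0, -⟩, hc, hh⟩
      exact ⟨H, hI, hc, hh⟩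
  · convert isCompact_empty
    ext x
    exact ⟨fun H => hI H.proper, fun H => H.elim⟩

theorem Near.exhausts {p S I c h b} (H : X.Near p S I c h b) {y} (hy : D.z y = p) :
    y ∈ range S :=
  (X.near H.level (H.slope.trans X.ε_le) H.nonneg H.le).1 y hy

theorem Near.compare (hD : D.Generic) {p S I c h b S' I' c' h' b'} (H : X.Near p S I c h b)
    (H' : D.Level p S' I' c' h' b') (hI' : I'.Proper) (hh' : 0 ≤ h') :
    c = c' ∧ b = b' ∧ h = h' ∧ (0 < h → I.card = I'.card) ∧
      (Monotone (D.u ∘ S') → S = S' ∧ (0 < h → I = I')) := by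
  obtain rfl := hD.slope_unique H.level H'
  have hr := H'.range_eq_of_exhausts hD fun y hy => H.exhausts hy
  obtain ⟨rfl, rfl⟩ := H.level.eq_of_range_eq H' H.proper hI' H.nonneg hh' hr
  refine ⟨rfl, rfl, rfl, fun h0 => H.level.card_eq_of_range_eq hD H' h0 hr, fun hm => ?_⟩
  have hSS : S = S' := by
    have hin := (X.near H.level (H.slope.trans X.ε_le) H.nonneg H.le).2
    have hin' := (X.near H' (H.slope.trans X.ε_le) H.nonneg H.le).2
    have : D.u ∘ S = D.u ∘ S' := by
      rw [← (H.mono.strictMono_of_injective hin).range_inj (hm.strictMono_of_injective hin'),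
        range_comp, range_comp, hr]
    funext i
    obtain ⟨j, hj⟩ : S i ∈ range S' := hr ▸ mem_range_self i
    have h1 : D.u (S' j) = D.u (S' i) := by
      rw [hj]; exact congrFun this i
    rw [← hj, hin' h1]
  subst hSS
  exact ⟨rfl, fun h0 => Finset.ext fun j => H.level.mem_iff_of_eq H' h0 rfl⟩

/-- Every proper level of small slope becomes near, after sorting, or is far. -/
theorem exists_sort (hD : D.Generic) {p S I c h b} (H : D.Level p S I c h b) (hI : I.Proper)
    (hc : |c| ≤ X.ε) (h0 : 0 ≤ h) (hh : h ≤ X.h₁) :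
    ∃ σ : Equiv.Perm (Fin r), X.Near p (S ∘ σ) (I.map σ.symm.toEmbedding) c h b := by
  refine ⟨Tuple.sort (D.u ∘ S), H.perm hD _, ⟨hI.1.map, fun hu => hI.2 ?_⟩, hc, h0, hh,
    Tuple.monotone_sort (D.u ∘ S)⟩
  rw [← Finset.card_eq_iff_eq_univ] at hu ⊢
  rwa [Finset.card_map] at hu

end Scale
end FibreData

/-- A pattern of slopes `eta` and gaps `rho`, depending on an index set, a slope and a gap, which
prescribes how levels are to be destroyed. -/
structure RaisingPattern (r : ℕ) where
  L : ℝ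
  eta : Finset (Fin r) → ℝ → ℝ → ℝ
  rho : Finset (Fin r) → ℝ → ℝ → ℝ
  etaFar : ℝ → ℝ
  rhoFar : ℕ → ℝ → ℝ
  side : Finset (Fin r) → Finset (Fin r) → Set (ℝ × ℝ)
  far : ℕ → Set ℝ
  L_pos : 0 < L
  continuous_eta : ∀ I, Continuous fun x : ℝ × ℝ => eta I x.1 x.2
  continuous_rho : ∀ I, Continuous fun x : ℝ × ℝ => rho I x.1 x.2
  isClosed_side : ∀ I J, IsClosed (side I J)
  isClosed_far : ∀ i, IsClosed (far i)
  eta_le : ∀ I c h, |eta I c h| ≤ L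
  rho_nonneg : ∀ I c h, 0 ≤ rho I c h
  eta_zero : ∀ I J c, eta I c 0 = eta J c 0
  rho_zero : ∀ I J c, rho I c 0 = rho J c 0
  eta_one : ∀ I c, eta I c 1 = etaFar c
  rho_one : ∀ I c, 2 * I.card ≤ r → rho I c 1 = rhoFar I.card c
  rho_eq_one_of_zero : ∀ I c, |c| ≤ L → eta I c 0 = c → rho I c 0 = 1
  rho_eq_one : ∀ I c h, 0 < h → h ≤ 1 → |c| ≤ L → eta I c h = c → (c, h) ∈ side I I →
    rho I c h = 1
  rhoFar_eq : ∀ i c, |c| ≤ L → etaFar c = c → rhoFar i c = 0 ∨ rhoFar i c = 1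
  exists_side : ∀ I c h, 0 ≤ h → h ≤ 1 → rho I c h ≠ 0 → ∃ J, (c, h) ∈ side I J
  mem_far : ∀ i c, rhoFar i c ≠ 0 → c ∈ far i
  side_unique : ∀ I J J' c h, 0 ≤ h → h ≤ 1 → (c, h) ∈ side I J → (c, h) ∈ side I J' → J = J'
  side_zero : ∀ I I' J J' c, (c, 0) ∈ side I J → (c, 0) ∈ side I' J' → J = J'
  side_one : ∀ I J c, (c, 1) ∈ side I J → J = I ∧ 2 * I.card ≤ r
  side_proper : ∀ I J c h, (c, h) ∈ side I J → J.Proper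

namespace FibreData.Scale

variable {r : ℕ} {K Z : Type*} [TopologicalSpace K] [TopologicalSpace Z] {D : FibreData r K Z}
  (X : D.Scale) (P : RaisingPattern r)

/-- Points of near levels over the active region whose index stands in the relation `R` to the
active index set. -/
def nearPts (R : Finset (Fin r) → Fin r → Prop) : Set K :=
  {y | ∃ p S I c h b J j, X.Near p S I c h b ∧ (c * (P.L / X.ε), h / X.h₁) ∈ P.side I J ∧ R J j ∧
    y = S j}

/-- Points over far levels whose height relative to the lowered level satisfies `R`. -/
def farPts (R : Set ℝ) : Set K :=
  {y | ∃ p S I c h b, X.Far p S I c h b ∧ 2 * I.card ≤ r ∧ c * (P.L / X.ε) ∈ P.far I.card ∧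
    D.z y = p ∧ D.t y + c * D.u y - (b - X.θ) ∈ R}

theorem isClosed_nearPts [CompactSpace K] [T2Space K] [T2Space Z] (hD : D.Generic)
    (R : Finset (Fin r) → Fin r → Prop) : IsClosed (X.nearPts P R) := by
  have : X.nearPts P R = ⋃ I, ⋃ J, ⋃ j, ⋃ (_ : R J j),
      (fun x : Z × (Fin r → K) × ℝ × ℝ × ℝ => x.2.1 j) ''
        ({x | X.Near x.1 x.2.1 I x.2.2.1 x.2.2.2.1 x.2.2.2.2} ∩
          {x | (x.2.2.1 * (P.L / X.ε), x.2.2.2.1 / X.h₁) ∈ P.side I J}) := by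
    ext y
    simp only [mem_iUnion]
    constructor
    · rintro ⟨p, S, I, c, h, b, J, j, h1, h2, h3, rfl⟩
      exact ⟨I, J, j, h3, (p, S, c, h, b), ⟨h1, h2⟩, rfl⟩
    · rintro ⟨I, J, j, h3, ⟨p, S, c, h, b⟩, ⟨h1, h2⟩, rfl⟩
      exact ⟨p, S, I, c, h, b, J, j, h1, h2, h3, rfl⟩
  rw [this]
  refine isClosed_iUnion_of_finite fun I => isClosed_iUnion_of_finite fun J =>
    isClosed_iUnion_of_finite fun j => isClosed_iUnion_of_finite fun _ => ?_
  refine (((isCompact_near hD X I).inter_right ?_).image (by fun_prop)).isClosed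
  exact (P.isClosed_side I J).preimage (by fun_prop)

theorem isClosed_farPts [CompactSpace K] [T2Space K] [T2Space Z] (hD : D.Generic)
    {R : Set ℝ} (hR : IsClosed R) : IsClosed (X.farPts P R) := by
  have : X.farPts P R = ⋃ I, ⋃ (_ : 2 * I.card ≤ r),
      Prod.snd '' (({x : Z × (Fin r → K) × ℝ × ℝ × ℝ |
          X.Far x.1 x.2.1 I x.2.2.1 x.2.2.2.1 x.2.2.2.2} ×ˢ (univ : Set K)) ∩
        {x | x.1.2.2.1 * (P.L / X.ε) ∈ P.far I.card ∧ D.z x.2 = x.1.1 ∧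
          D.t x.2 + x.1.2.2.1 * D.u x.2 - (x.1.2.2.2.2 - X.θ) ∈ R}) := by
    ext y
    simp only [mem_iUnion]
    constructor
    · rintro ⟨p, S, I, c, h, b, h1, h2, h3, h4, h5⟩
      exact ⟨I, h2, ((p, S, c, h, b), y), ⟨⟨h1, trivial⟩, h3, h4, h5⟩, rfl⟩
    · rintro ⟨I, h2, ⟨⟨p, S, c, h, b⟩, y⟩, ⟨⟨h1, -⟩, h3, h4, h5⟩, rfl⟩
      exact ⟨p, S, I, c, h, b, h1, h2, h3, h4, h5⟩
  rw [this]
  refine isClosed_iUnion_of_finite fun I => isClosed_iUnion_of_finite fun _ => ?_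
  refine ((((isCompact_far hD X I).prod isCompact_univ).inter_right ?_).image
    continuous_snd).isClosed
  refine IsClosed.and ?_ (IsClosed.and ?_ ?_)
  · exact (P.isClosed_far I.card).preimage
      (f := fun x : (Z × (Fin r → K) × ℝ × ℝ × ℝ) × K => x.1.2.2.1 * (P.L / X.ε)) (by fun_prop)
  · exact isClosed_eq (by fun_prop) (by fun_prop)
  · exact hR.preimage (f := fun x : (Z × (Fin r → K) × ℝ × ℝ × ℝ) × K =>
      D.t x.2 + x.1.2.2.1 * D.u x.2 - (x.1.2.2.2.2 - X.θ)) (by fun_prop)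

/-- Points to be raised. -/
def raised : Set K := X.nearPts P (fun J j => j ∈ J) ∪ X.farPts P (Iic 0)

/-- Points to be kept. -/
def kept : Set K := X.nearPts P (fun J j => j ∉ J) ∪ X.farPts P (Ici 0)

variable {X P}

theorem Near.scaled {p S I c h b} (H : X.Near p S I c h b) :
    0 ≤ h / X.h₁ ∧ h / X.h₁ ≤ 1 :=
  ⟨div_nonneg H.nonneg X.h₁_pos.le, (div_le_one X.h₁_pos).2 H.le⟩

theorem disjoint_raised_kept (hD : D.Generic) : Disjoint (X.raised P) (X.kept P) := by
  rw [Set.disjoint_left]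
  have aux : ∀ {p S I c h b J S' I' c' h' b'}, X.Near p S I c h b →
      (c * (P.L / X.ε), h / X.h₁) ∈ P.side I J → X.Far p S' I' c' h' b' →
      c = c' ∧ J = I ∧ b = b' ∧ h = X.h₁ := by
    intro p S I c h b J S' I' c' h' b' H hs H'
    obtain ⟨rfl, rfl, rfl, -⟩ := H.compare hD H'.level H'.proper H'.pos.le
    have hh := le_antisymm H.le H'.le
    rw [hh, div_self X.h₁_pos.ne'] at hs
    exact ⟨rfl, (P.side_one _ _ _ hs).1, rfl, hh⟩
  rintro y (⟨p, S, I, c, h, b, J, j, H, hs, hj, rfl⟩ | ⟨p, S, I, c, h, b, H, hI, hf, rfl, hy⟩)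
  · rintro (⟨p', S', I', c', h', b', J', j', H', hs', hj', hjj⟩ |
      ⟨p', S', I', c', h', b', H', hI', hf', rfl, hy'⟩)
    · have hp : p = p' := by rw [← H.level.fib j, hjj, H'.level.fib j']
      subst hp
      obtain ⟨rfl, rfl, rfl, -, h5⟩ := H.compare hD H'.level H'.proper H'.nonneg
      obtain ⟨rfl, h6⟩ := h5 H'.mono
      obtain rfl := hD.inj _ H.level.mem hjj
      apply hj'
      suffices J = J' from this ▸ hj
      rcases H.nonneg.eq_or_lt with h0 | h0
      · rw [← h0, zero_div] at hs hs'
        exact P.side_zero _ _ _ _ _ hs hs'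
      · obtain rfl := h6 h0
        exact P.side_unique _ _ _ _ _ H.scaled.1 H.scaled.2 hs hs'
    · rw [H.level.fib j] at H'
      obtain ⟨rfl, rfl, rfl, rfl⟩ := aux H hs H'
      rw [H.level.eq_of_mem hj, mem_Ici] at hy'
      linarith [X.θ_lt]
  · rintro (⟨p', S', I', c', h', b', J', j', H', hs', hj', rfl⟩ |
      ⟨p', S', I', c', h', b', H', hI', hf', hp, hy'⟩)
    · rw [H'.level.fib j'] at H
      obtain ⟨rfl, rfl, rfl, rfl⟩ := aux H' hs' H
      rw [H'.level.eq_of_notMem hj', mem_Iic] at hy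
      linarith [X.θ_pos]
    · subst hp
      obtain rfl := hD.slope_unique H.level H'.level
      refine ((X.far H.level H'.level H.proper H'.proper H.slope (H.slope.trans X.ε_le_one)
        H.le H'.le hI).1 hI').2 y rfl ⟨?_, ?_⟩
      · rw [mem_Iic] at hy; linarith
      · rw [mem_Ici] at hy'; linarith

/-- Every point in the fibre of a near level over the active region is raised or kept. -/
theorem Near.mem_raised_or_kept {p S I c h b J y} (H : X.Near p S I c h b)
    (hs : (c * (P.L / X.ε), h / X.h₁) ∈ P.side I J) (hy : D.z y = p) :
    y ∈ X.raised P ∨ y ∈ X.kept P := by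
  obtain ⟨j, rfl⟩ := H.exhausts hy
  by_cases hj : j ∈ J
  · exact Or.inl (Or.inl ⟨p, S, I, c, h, b, J, j, H, hs, hj, rfl⟩)
  · exact Or.inr (Or.inl ⟨p, S, I, c, h, b, J, j, H, hs, hj, rfl⟩)

theorem Far.mem_raised_or_kept {p S I c h b y} (H : X.Far p S I c h b) (hI : 2 * I.card ≤ r)
    (hf : c * (P.L / X.ε) ∈ P.far I.card) (hy : D.z y = p) :
    y ∈ X.raised P ∨ y ∈ X.kept P := by
  rcases le_total (D.t y + c * D.u y - (b - X.θ)) 0 with h0 | h0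
  · exact Or.inl (Or.inr ⟨p, S, I, c, h, b, H, hI, hf, hy, h0⟩)
  · exact Or.inr (Or.inr ⟨p, S, I, c, h, b, H, hI, hf, hy, h0⟩)

/-- A base point is active if it carries a raised or kept point. -/
def active (X : D.Scale) (P : RaisingPattern r) : Set Z := D.z '' (X.raised P ∪ X.kept P)

theorem mem_raised_or_kept_of_active {y} (hy : D.z y ∈ X.active P) :
    y ∈ X.raised P ∨ y ∈ X.kept P := by
  obtain ⟨x, hx, hxy⟩ := hy
  rcases hx with (⟨p, S, I, c, h, b, J, j, H, hs, hj, rfl⟩ |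
    ⟨p, S, I, c, h, b, H, hI, hf, rfl, hx⟩) | (⟨p, S, I, c, h, b, J, j, H, hs, hj, rfl⟩ |
    ⟨p, S, I, c, h, b, H, hI, hf, rfl, hx⟩)
  · exact H.mem_raised_or_kept hs (hxy.symm.trans (H.level.fib j))
  · exact H.mem_raised_or_kept hI hf hxy.symm
  · exact H.mem_raised_or_kept hs (hxy.symm.trans (H.level.fib j))
  · exact H.mem_raised_or_kept hI hf hxy.symm

theorem Near.active {p S I c h b J} (hr : 3 ≤ r) (H : X.Near p S I c h b)
    (hs : (c * (P.L / X.ε), h / X.h₁) ∈ P.side I J) : p ∈ X.active P := by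
  have hp := H.level.fib ⟨0, by omega⟩
  exact ⟨_, H.mem_raised_or_kept hs hp, hp⟩

theorem Far.active {p S I c h b} (hr : 3 ≤ r) (H : X.Far p S I c h b) (hI : 2 * I.card ≤ r)
    (hf : c * (P.L / X.ε) ∈ P.far I.card) : p ∈ X.active P := by
  have hp := H.level.fib ⟨0, by omega⟩
  exact ⟨_, H.mem_raised_or_kept hI hf hp, hp⟩

/-- Over the active region, a far level with a large index set has a kept point in that set. -/
theorem Far.exists_kept_of_active (hD : D.Generic) {p S I c h b} (H : X.Far p S I c h b)
    (hI : r < 2 * I.card) (hp : p ∈ X.active P) : ∃ j ∈ I, S j ∈ X.kept P := by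
  have hfar : ∀ {S' I' c' h' b'}, X.Far p S' I' c' h' b' → 2 * I'.card ≤ r →
      c' * (P.L / X.ε) ∈ P.far I'.card → ∃ j ∈ I, S j ∈ X.kept P := by
    intro S' I' c' h' b' H' hI' hf
    obtain rfl := hD.slope_unique H.level H'.level
    obtain ⟨j, hj, hjb⟩ := (X.far H'.level H.level H'.proper H.proper H'.slope
      (H'.slope.trans X.ε_le_one) H'.le H.le hI').2 hI
    refine ⟨j, hj, Or.inr ⟨p, S', I', c, h', b', H', hI', hf, H.level.fib j, ?_⟩⟩
    rw [mem_Ici]; linarith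
  have hnear : ∀ {S' I' c' h' b' J}, X.Near p S' I' c' h' b' →
      (c' * (P.L / X.ε), h' / X.h₁) ∈ P.side I' J → False := by
    intro S' I' c' h' b' J H' hs
    obtain ⟨rfl, rfl, rfl, h5, -⟩ := H'.compare hD H.level H.proper H.pos.le
    rw [le_antisymm H'.le H.le, div_self X.h₁_pos.ne'] at hs
    have := (P.side_one _ _ _ hs).2
    have := h5 H.pos
    omega
  obtain ⟨x, hx, hxy⟩ := hp
  rcases hx with (⟨p', S', I', c', h', b', J, j, H', hs, hj, rfl⟩ |
    ⟨p', S', I', c', h', b', H', hI', hf, hx', hx⟩) |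
    (⟨p', S', I', c', h', b', J, j, H', hs, hj, rfl⟩ |
    ⟨p', S', I', c', h', b', H', hI', hf, hx', hx⟩)
  · rw [H'.level.fib j] at hxy; subst hxy
    exact (hnear H' hs).elim
  · rw [hx'] at hxy; subst hxy
    exact hfar H' hI' hf
  · rw [H'.level.fib j] at hxy; subst hxy
    exact (hnear H' hs).elim
  · rw [hx'] at hxy; subst hxy
    exact hfar H' hI' hf

theorem exists_slope_gap [CompactSpace K] [T2Space Z] [NormalSpace Z] (hD : D.Generic) :
    ∃ η ρ : C(Z, ℝ), (∀ p, |η p| ≤ X.ε) ∧ (∀ p, 0 ≤ ρ p) ∧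
      (∀ {p S I c h b}, X.Near p S I c h b →
        η p * (P.L / X.ε) = P.eta I (c * (P.L / X.ε)) (h / X.h₁) ∧
        ρ p = (X.B + 1) * P.rho I (c * (P.L / X.ε)) (h / X.h₁)) ∧
      (∀ {p S I c h b}, X.Far p S I c h b →
        η p * (P.L / X.ε) = P.etaFar (c * (P.L / X.ε)) ∧
        (2 * I.card ≤ r → ρ p = (X.B + 1) * P.rhoFar I.card (c * (P.L / X.ε)))) := by
  have hLε : 0 < P.L / X.ε := div_pos P.L_pos X.ε_pos
  let N : Finset (Fin r) → Set (Z × (Fin r → K) × ℝ × ℝ × ℝ) := fun I =>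
    {x | X.Near x.1 x.2.1 I x.2.2.1 x.2.2.2.1 x.2.2.2.2}
  let F : Finset (Fin r) → Set (Z × (Fin r → K) × ℝ × ℝ × ℝ) := fun I =>
    {x | X.Far x.1 x.2.1 I x.2.2.1 x.2.2.2.1 x.2.2.2.2}
  let F' : Finset (Fin r) → Set (Z × (Fin r → K) × ℝ × ℝ × ℝ) := fun I =>
    {x | X.Far x.1 x.2.1 I x.2.2.1 x.2.2.2.1 x.2.2.2.2 ∧ 2 * I.card ≤ r}
  have hF' : ∀ I, IsCompact (F' I) := fun I => (isCompact_far hD X I).inter_right isClosed_const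
  have near_near : ∀ {p S I c h b S' I' c' h' b'} (f : Finset (Fin r) → ℝ → ℝ → ℝ),
      (∀ I J c, f I c 0 = f J c 0) → X.Near p S I c h b → X.Near p S' I' c' h' b' →
      f I (c * (P.L / X.ε)) (h / X.h₁) = f I' (c' * (P.L / X.ε)) (h' / X.h₁) := by
    intro p S I c h b S' I' c' h' b' f hf H H'
    obtain ⟨rfl, rfl, rfl, -, h5⟩ := H.compare hD H'.level H'.proper H'.nonneg
    rcases H.nonneg.eq_or_lt with h0 | h0
    · rw [← h0, zero_div]
      exact hf _ _ _
    · rw [(h5 H'.mono).2 h0]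
  have near_far : ∀ {p S I c h b S' I' c' h' b'}, X.Near p S I c h b → X.Far p S' I' c' h' b' →
      c = c' ∧ h / X.h₁ = 1 ∧ I.card = I'.card := by
    intro p S I c h b S' I' c' h' b' H H'
    obtain ⟨rfl, rfl, rfl, h5, -⟩ := H.compare hD H'.level H'.proper H'.pos.le
    rw [le_antisymm H.le H'.le, div_self X.h₁_pos.ne']
    exact ⟨rfl, rfl, h5 H'.pos⟩
  obtain ⟨η, hη, hηe⟩ := exists_descend_extend (ι := Finset (Fin r) ⊕ Finset (Fin r))
    (Sum.elim N F) (Sum.rec (isCompact_near hD X) (isCompact_far hD X)) continuous_fst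
    (v := Sum.elim
      (fun I x => (P.L / X.ε)⁻¹ * P.eta I (x.2.2.1 * (P.L / X.ε)) (x.2.2.2.1 / X.h₁))
      (fun I x => (P.L / X.ε)⁻¹ * P.eta I (x.2.2.1 * (P.L / X.ε)) 1))
    (by
      rintro (I | I)
      · exact continuous_const.mul ((P.continuous_eta I).comp
          (f := fun x : Z × (Fin r → K) × ℝ × ℝ × ℝ =>
            (x.2.2.1 * (P.L / X.ε), x.2.2.2.1 / X.h₁)) (by fun_prop))
      · exact continuous_const.mul ((P.continuous_eta I).comp
          (f := fun x : Z × (Fin r → K) × ℝ × ℝ × ℝ =>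
            (x.2.2.1 * (P.L / X.ε), (1 : ℝ))) (by fun_prop)))
    (s := Icc (-X.ε) X.ε) ⟨0, by simp [X.ε_pos.le]⟩
    (by
      have key : ∀ I c h, (P.L / X.ε)⁻¹ * P.eta I c h ∈ Icc (-X.ε) X.ε := fun I c h => by
        rw [mem_Icc, ← abs_le, abs_mul, abs_of_pos (inv_pos.2 hLε), inv_mul_le_iff₀ hLε,
          div_mul_cancel₀ _ X.ε_pos.ne']
        exact P.eta_le _ _ _
      rintro (I | I) x -
      · exact key _ _ _
      · exact key _ _ _)
    (by
      rintro (I | I) (I' | I') ⟨p, S, c, h, b⟩ H ⟨p', S', c', h', b'⟩ H' hp <;>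
        obtain rfl : p = p' := hp <;> dsimp only [Sum.elim_inl, Sum.elim_inr]
      · rw [near_near P.eta P.eta_zero H H']
      · obtain ⟨rfl, h1, -⟩ := near_far H H'
        rw [h1, P.eta_one, P.eta_one]
      · obtain ⟨rfl, h1, -⟩ := near_far H' H
        rw [h1, P.eta_one, P.eta_one]
      · have H : X.Far p S I c h b := H
        have H' : X.Far p S' I' c' h' b' := H'
        obtain rfl := hD.slope_unique H.level H'.level
        rw [P.eta_one, P.eta_one])
  obtain ⟨ρ, hρ, hρe⟩ := exists_descend_extend (ι := Finset (Fin r) ⊕ Finset (Fin r))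
    (Sum.elim N F') (Sum.rec (isCompact_near hD X) hF') continuous_fst
    (v := Sum.elim
      (fun I x => (X.B + 1) * P.rho I (x.2.2.1 * (P.L / X.ε)) (x.2.2.2.1 / X.h₁))
      (fun I x => (X.B + 1) * P.rho I (x.2.2.1 * (P.L / X.ε)) 1))
    (by
      rintro (I | I)
      · exact continuous_const.mul ((P.continuous_rho I).comp
          (f := fun x : Z × (Fin r → K) × ℝ × ℝ × ℝ =>
            (x.2.2.1 * (P.L / X.ε), x.2.2.2.1 / X.h₁)) (by fun_prop))
      · exact continuous_const.mul ((P.continuous_rho I).comp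
          (f := fun x : Z × (Fin r → K) × ℝ × ℝ × ℝ =>
            (x.2.2.1 * (P.L / X.ε), (1 : ℝ))) (by fun_prop)))
    (s := Ici 0) ⟨0, by simp⟩
    (by
      have hB : 0 ≤ X.B + 1 := by linarith [X.one_le_B]
      rintro (I | I) x -
      · exact mul_nonneg hB (P.rho_nonneg _ _ _)
      · exact mul_nonneg hB (P.rho_nonneg _ _ _))
    (by
      rintro (I | I) (I' | I') ⟨p, S, c, h, b⟩ H ⟨p', S', c', h', b'⟩ H' hp <;>
        obtain rfl : p = p' := hp <;> dsimp only [Sum.elim_inl, Sum.elim_inr]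
      · rw [near_near P.rho P.rho_zero H H']
      · obtain ⟨rfl, h1, h2⟩ := near_far H H'.1
        rw [h1, P.rho_one I _ (h2 ▸ H'.2), P.rho_one I' _ H'.2, h2]
      · obtain ⟨rfl, h1, h2⟩ := near_far H' H.1
        rw [h1, P.rho_one I' _ (h2 ▸ H.2), P.rho_one I _ H.2, h2]
      · obtain ⟨H, hI⟩ : X.Far p S I c h b ∧ _ := H
        obtain ⟨H', hI'⟩ : X.Far p S' I' c' h' b' ∧ _ := H'
        obtain rfl := hD.slope_unique H.level H'.level
        rw [P.rho_one _ _ hI, P.rho_one _ _ hI', ((X.far H.level H'.level H.proper H'.proper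
          H.slope (H.slope.trans X.ε_le_one) H.le H'.le hI).1 hI').1])
  refine ⟨η, ρ, fun p => abs_le.2 (hη p), fun p => hρ p, ?_, ?_⟩
  · intro p S I c h b H
    refine ⟨?_, hρe (Sum.inl I) (p, S, c, h, b) H⟩
    rw [show η p = _ from hηe (Sum.inl I) (p, S, c, h, b) H]
    dsimp only [Sum.elim_inl]
    rw [mul_comm, mul_inv_cancel_left₀ hLε.ne']
  · intro p S I c h b H
    refine ⟨?_, fun hI => ?_⟩
    · rw [show η p = _ from hηe (Sum.inr I) (p, S, c, h, b) H]
      dsimp only [Sum.elim_inr]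
      rw [mul_comm, mul_inv_cancel_left₀ hLε.ne', P.eta_one]
    · rw [← P.rho_one I _ hI]
      exact hρe (Sum.inr I) (p, S, c, h, b) ⟨H, hI⟩

end FibreData.Scale

namespace FibreData

variable {r : ℕ} {K Z : Type*} [TopologicalSpace K] [TopologicalSpace Z] {D : FibreData r K Z}

namespace Scale

variable {X : D.Scale} {P : RaisingPattern r}

theorem isClosed_active [CompactSpace K] [T2Space K] [T2Space Z] (hD : D.Generic) :
    IsClosed (X.active P) := by
  refine (IsCompact.image (IsClosed.isCompact ?_) D.z.continuous).isClosed
  exact ((X.isClosed_nearPts P hD _).union (X.isClosed_farPts P hD isClosed_Iic)).union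
    ((X.isClosed_nearPts P hD _).union (X.isClosed_farPts P hD isClosed_Ici))

/-- Base points of far levels with a large index set on which `q` is large. -/
def blocked (X : D.Scale) (q : C(K, ℝ)) : Set Z :=
  {p | ∃ S I c h b, X.Far p S I c h b ∧ r < 2 * I.card ∧ ∀ j ∈ I, 3 / 4 ≤ q (S j)}

theorem isClosed_blocked [CompactSpace K] [T2Space Z] (hD : D.Generic) (X : D.Scale)
    (q : C(K, ℝ)) : IsClosed (X.blocked q) := by
  have : X.blocked q = ⋃ I, ⋃ (_ : r < 2 * I.card),
      Prod.fst '' ({x : Z × (Fin r → K) × ℝ × ℝ × ℝ |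
          X.Far x.1 x.2.1 I x.2.2.1 x.2.2.2.1 x.2.2.2.2} ∩
        {x | ∀ j ∈ I, 3 / 4 ≤ q (x.2.1 j)}) := by
    ext p
    simp only [mem_iUnion]
    constructor
    · rintro ⟨S, I, c, h, b, h1, h2, h3⟩
      exact ⟨I, h2, (p, S, c, h, b), ⟨h1, h3⟩, rfl⟩
    · rintro ⟨I, h2, ⟨p, S, c, h, b⟩, ⟨h1, h3⟩, rfl⟩
      exact ⟨S, I, c, h, b, h1, h2, h3⟩
  rw [this]
  refine isClosed_iUnion_of_finite fun I => isClosed_iUnion_of_finite fun _ => ?_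
  refine (((isCompact_far hD X I).inter_right ?_).image continuous_fst).isClosed
  simp only [ofPred_forall]
  exact isClosed_iInter fun j => isClosed_iInter fun _ => isClosed_le (by fun_prop) (by fun_prop)

end Scale

/-- Given a raising pattern, generic data can be modified so that no admissible tuple over a
single base point is constant. -/
theorem Generic.exists_nonconstant [CompactSpace K] [T2Space K] [T2Space Z] [NormalSpace Z]
    (hD : D.Generic) (P : RaisingPattern r) :
    ∃ t' : C(K, ℝ), ∀ S ∈ D.T, ∀ p, (∀ j, D.z (S j) = p) → ∀ b, ¬ ∀ j, t' (S j) = b := by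
  obtain ⟨X⟩ := hD.nonempty_scale
  obtain ⟨η, ρ, hη, hρ, hnear, hfar⟩ := Scale.exists_slope_gap (X := X) (P := P) hD
  have h3 := hD.three_le
  obtain ⟨q, hq0, hq1, hq⟩ := exists_continuous_zero_one_of_isClosed
    ((X.isClosed_nearPts P hD _).union (X.isClosed_farPts P hD isClosed_Ici) :
      IsClosed (X.kept P))
    ((X.isClosed_nearPts P hD _).union (X.isClosed_farPts P hD isClosed_Iic) :
      IsClosed (X.raised P)) (Scale.disjoint_raised_kept hD).symm
  let C : Set K := {x | 1 / 4 ≤ q x ∧ q x ≤ 3 / 4}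
  have hC : IsClosed C := by
    refine IsClosed.and ?_ ?_
    · exact isClosed_le (by fun_prop) (by fun_prop)
    · exact isClosed_le (by fun_prop) (by fun_prop)
  have hdisj : Disjoint (D.z '' C ∪ X.blocked q) (X.active P) := by
    rw [Set.disjoint_left]
    rintro p (⟨x, hx, rfl⟩ | ⟨S, I, c, h, b, H, hI, hqI⟩) hp
    · rcases Scale.mem_raised_or_kept_of_active hp with h | h
      · have : q x = 1 := hq1 h
        linarith [hx.2]
      · have : q x = 0 := hq0 h
        linarith [hx.1]
    · obtain ⟨j, hj, hjk⟩ := H.exists_kept_of_active hD hI hp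
      have : q (S j) = 0 := hq0 hjk
      linarith [hqI j hj]
  obtain ⟨l, hl0, hl1, hl⟩ := exists_continuous_zero_one_of_isClosed
    ((hC.isCompact.image D.z.continuous).isClosed.union (Scale.isClosed_blocked hD X q))
    (Scale.isClosed_active hD) hdisj
  let χ : C(K, ℝ) := ⟨fun x => max 0 (min 1 (2 * q x - 1 / 2)), by fun_prop⟩
  have χ_zero : ∀ x, q x ≤ 1 / 4 → χ x = 0 := fun x hx =>
    max_eq_left ((min_le_right _ _).trans (by linarith))
  have χ_one : ∀ x, 3 / 4 ≤ q x → χ x = 1 := fun x hx => by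
    change max 0 (min 1 (2 * q x - 1 / 2)) = 1
    rw [min_eq_left (by linarith), max_eq_right zero_le_one]
  have q_of_χ : ∀ x, χ x = 1 → 3 / 4 ≤ q x := fun x hx => by
    by_contra! hcon
    have : max 0 (min 1 (2 * q x - 1 / 2)) = 1 := hx
    rcases max_choice 0 (min 1 (2 * q x - 1 / 2)) with h | h <;> rw [this] at h
    · norm_num at h
    · have := min_le_right 1 (2 * q x - 1 / 2)
      linarith
  -- the effective gap
  let g : C(Z, ℝ) := ρ * l
  have hg0 : ∀ p, 0 ≤ g p := fun p => mul_nonneg (hρ p) (hl p).1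
  have g_active : ∀ p ∈ X.active P, g p = ρ p := fun p hp => by
    change ρ p * l p = ρ p
    rw [show l p = 1 from hl1 hp, mul_one]
  have l_zero : ∀ p, p ∈ D.z '' C ∪ X.blocked q → g p = 0 := fun p hp => by
    change ρ p * l p = 0
    rw [show l p = 0 from hl0 hp, mul_zero]
  have ηL : ∀ p, |η p * (P.L / X.ε)| ≤ P.L := fun p => by
    rw [abs_mul, abs_of_pos (div_pos P.L_pos X.ε_pos), mul_div_assoc', div_le_iff₀ X.ε_pos,
      mul_comm P.L]
    exact mul_le_mul_of_nonneg_right (hη p) P.L_pos.le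
  have χ_near : ∀ {p S I c h b J}, X.Near p S I c h b →
      (c * (P.L / X.ε), h / X.h₁) ∈ P.side I J → ∀ j, (j ∈ J → χ (S j) = 1) ∧
        (j ∉ J → χ (S j) = 0) := by
    intro p S I c h b J H hs j
    constructor
    · intro hj
      apply χ_one
      rw [show q (S j) = 1 from hq1 (Or.inl ⟨p, S, I, c, h, b, J, j, H, hs, hj, rfl⟩)]
      norm_num
    · intro hj
      apply χ_zero
      rw [show q (S j) = 0 from hq0 (Or.inl ⟨p, S, I, c, h, b, J, j, H, hs, hj, rfl⟩)]
      norm_num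
  refine ⟨D.t + (η.comp D.z) * D.u + (g.comp D.z) * χ, fun S hS p hp b hb => ?_⟩
  have hb : ∀ j, D.t (S j) + η p * D.u (S j) + g p * χ (S j) = b := fun j => by
    have := hb j
    simp only [ContinuousMap.add_apply, ContinuousMap.mul_apply, ContinuousMap.comp_apply,
      hp j] at this
    exact this
  -- the unraised case
  have case1 : ∀ b, (∀ j, D.t (S j) + η p * D.u (S j) = b) →
      (g p ≠ 0 → ∀ i j, χ (S i) = χ (S j)) → False := by
    intro b hb hχ
    let I : Finset (Fin r) := {⟨0, by omega⟩}
    have hI : I.Proper := ⟨Finset.singleton_nonempty _, fun h => by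
      have := congrArg Finset.card h
      simp [I] at this
      omega⟩
    have H : D.Level p S I (η p) 0 b := ⟨hS, hp, fun j => by simpa using hb j⟩
    obtain ⟨σ, H⟩ := Scale.exists_sort (X := X) hD H hI (hη p) le_rfl X.h₁_pos.le
    obtain ⟨e1, e2⟩ := hnear H
    rw [zero_div] at e1 e2
    rw [P.rho_eq_one_of_zero _ _ (ηL p) e1.symm] at e2
    obtain ⟨J, hJ⟩ := P.exists_side (I.map σ.symm.toEmbedding) (η p * (P.L / X.ε)) 0 le_rfl
      zero_le_one (by rw [P.rho_eq_one_of_zero _ _ (ηL p) e1.symm]; exact one_ne_zero)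
    rw [← zero_div X.h₁] at hJ
    have hg : g p ≠ 0 := by
      rw [g_active p (H.active h3 hJ), e2]
      linarith [X.one_le_B]
    have hJp := P.side_proper _ _ _ _ hJ
    obtain ⟨i, hi⟩ := hJp.1
    obtain ⟨j, hj⟩ := hJp.exists_notMem
    have := hχ hg (σ i) (σ j)
    rw [show χ (S (σ i)) = 1 from (χ_near H hJ i).1 hi,
      show χ (S (σ j)) = 0 from (χ_near H hJ j).2 hj] at this
    exact one_ne_zero this
  rcases (hg0 p).eq_or_lt with hg | hg
  · exact case1 b (fun j => by simpa [← hg] using hb j) fun h => absurd hg.symm h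
  have hχ : ∀ j, χ (S j) = 0 ∨ χ (S j) = 1 := fun j => by
    by_contra! hcon
    refine hg.ne' (l_zero p (Or.inl ⟨S j, ⟨?_, ?_⟩, hp j⟩))
    · by_contra! h
      exact hcon.1 (χ_zero _ h.le)
    · by_contra! h
      exact hcon.2 (χ_one _ h.le)
  classical
  let I : Finset (Fin r) := Finset.univ.filter fun j => χ (S j) = 1
  have memI : ∀ j, j ∈ I ↔ χ (S j) = 1 := fun j => by simp [I]
  have H : D.Level p S I (η p) (g p) b := ⟨hS, hp, fun j => by
    rw [← hb j]
    by_cases hj : j ∈ I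
    · rw [if_pos hj, (memI j).1 hj, mul_one]
    · rw [if_neg hj, (hχ j).resolve_right fun h => hj ((memI j).2 h), mul_zero]⟩
  by_cases hI : I.Proper
  swap
  · have : I = ∅ ∨ I = Finset.univ := by
      by_contra! hcon
      exact hI ⟨hcon.1, hcon.2⟩
    rcases this with hI | hI
    · have h0 : ∀ j, χ (S j) = 0 := fun j => (hχ j).resolve_right fun h => by
        simpa [hI] using (memI j).2 h
      exact case1 b (fun j => by simpa [h0] using hb j) fun _ i j => by rw [h0, h0]
    · have h0 : ∀ j, χ (S j) = 1 := fun j => (memI j).1 (hI ▸ Finset.mem_univ j)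
      refine case1 (b - g p) (fun j => ?_) fun _ i j => by rw [h0, h0]
      have := hb j
      rw [h0] at this
      linarith
  have gap := X.gap_le H hI ((hη p).trans X.ε_le_one)
  have contra : p ∈ X.active P → ρ p = (X.B + 1) * 1 → False := fun hp h => by
    rw [g_active p hp, h] at gap
    linarith
  rcases le_total (g p) X.h₁ with hgh | hgh
  · obtain ⟨σ, N⟩ := Scale.exists_sort (X := X) hD H hI (hη p) hg.le hgh
    obtain ⟨e1, e2⟩ := hnear N
    obtain ⟨J, hJ⟩ := P.exists_side (I.map σ.symm.toEmbedding) (η p * (P.L / X.ε))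
      (g p / X.h₁) N.scaled.1 N.scaled.2 fun h => by
        rw [h, mul_zero] at e2
        refine hg.ne' ?_
        change ρ p * l p = 0
        rw [e2, zero_mul]
    have hJI : J = I.map σ.symm.toEmbedding := by
      ext j
      rw [Finset.mem_map_equiv, Equiv.symm_symm, memI]
      have := χ_near N hJ j
      refine ⟨this.1, fun h => ?_⟩
      by_contra hj
      have h' : χ (S (σ j)) = 0 := this.2 hj
      rw [h] at h'
      exact one_ne_zero h'
    have hJ' := hJ
    rw [hJI] at hJ'
    refine contra (N.active h3 hJ) ?_
    rw [e2, P.rho_eq_one _ _ _ (div_pos hg X.h₁_pos) N.scaled.2 (ηL p) e1.symm hJ']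
  · have F : X.Far p S I (η p) (g p) b := ⟨H, hI, hη p, hgh⟩
    obtain ⟨e1, e2⟩ := hfar F
    rcases le_or_gt (2 * I.card) r with hc | hc
    · rcases P.rhoFar_eq I.card _ (ηL p) e1.symm with h | h
      · have := e2 hc
        rw [h, mul_zero] at this
        refine hg.ne' ?_
        change ρ p * l p = 0
        rw [this, zero_mul]
      · refine contra (F.active h3 hc (P.mem_far _ _ ?_)) ?_
        · rw [h]; exact one_ne_zero
        · rw [e2 hc, h]
    · refine hg.ne' (l_zero p (Or.inr ⟨S, I, η p, g p, b, F, hc, fun j hj => ?_⟩))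
      exact q_of_χ _ ((memI j).1 hj)

end FibreData

/-- Consecutive blocks of prescribed sizes. -/
theorem exists_blocks {α : Type*} [Fintype α] (f : α → ℕ) :
    ∃ P : α → ℕ, (∀ a, ∀ k < f a, P a + k < ∑ a, f a) ∧
      (∀ m < ∑ a, f a, ∃ a, ∃ k < f a, P a + k = m) ∧
      ∀ a a', ∀ k < f a, ∀ k' < f a', P a + k = P a' + k' → a = a' := by
  let e := Fintype.equivFin α
  let F : Fin (Fintype.card α) → ℕ := fun i => f (e.symm i)
  have hsum : ∑ i, F i = ∑ a, f a := e.symm.sum_comp f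
  let P : α → ℕ := fun a => ∑ i : Fin (e a).1, F (Fin.castLE (e a).2.le i)
  have hP : ∀ a k (hk : k < f a), P a + k =
      (finSigmaFinEquiv (⟨e a, ⟨k, by simpa [F] using hk⟩⟩ : Σ i, Fin (F i)) : ℕ) := by
    intro a k hk
    rw [finSigmaFinEquiv_apply]
  refine ⟨P, fun a k hk => ?_, fun m hm => ?_, fun a a' k hk k' hk' h => ?_⟩
  · rw [hP a k hk, ← hsum]
    exact Fin.is_lt _
  · rw [← hsum] at hm
    obtain ⟨⟨i, k⟩, hx⟩ := (finSigmaFinEquiv (n := F)).surjective ⟨m, hm⟩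
    obtain ⟨a, rfl⟩ := e.surjective i
    have hk : k.1 < f a := by simpa [F] using k.2
    refine ⟨a, k, hk, ?_⟩
    rw [hP a k hk]
    exact congrArg Fin.val hx
  · rw [hP a k hk, hP a' k' hk'] at h
    have := finSigmaFinEquiv.injective (Fin.ext h)
    exact e.injective (congrArg Sigma.fst this)

/-- A distribution of the integers `0, …, 2 * H` among the subsets of `Fin r` such that the shares
of subsets of equal size are even translates of each other. -/
structure SlotSystem (r : ℕ) where
  H : ℕ
  A : Finset (Fin r) → Finset ℤ
  A₀ : ℕ → Finset ℤ
  τ : Finset (Fin r) → ℤ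
  unique : ∀ {I J l}, l ∈ A I → l ∈ A J → I = J
  exists_mem : ∀ {l : ℤ}, 0 ≤ l → l ≤ 2 * H → ∃ I, l ∈ A I
  bounds : ∀ {I l}, l ∈ A I → 0 ≤ l ∧ l ≤ 2 * H
  bounds₀ : ∀ {i l}, l ∈ A₀ i → 0 ≤ l ∧ l ≤ 2 * H
  shift : ∀ I l, l + 2 * τ I ∈ A I ↔ l ∈ A₀ I.card
  card : ∀ {I l}, l ∈ A I → 1 ≤ I.card ∧ 2 * I.card ≤ r

theorem exists_slotSystem {r : ℕ} (n : ℕ → ℤ) (hn : ∀ i, n i ≠ 0 → 1 ≤ i ∧ 2 * i ≤ r)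
    (hsum : ∑ I : Finset (Fin r), n I.card = 1) : Nonempty (SlotSystem r) := by
  let pos : Finset (Fin r) → ℕ := fun I => (n I.card).toNat
  let neg : Finset (Fin r) → ℕ := fun I => (-n I.card).toNat
  obtain ⟨P, hP1, hP2, hP3⟩ := exists_blocks pos
  obtain ⟨Q, hQ1, hQ2, hQ3⟩ := exists_blocks neg
  set H := ∑ I, neg I with hH
  have hpos : ∑ I, pos I = H + 1 := by
    have : ((∑ I, pos I : ℕ) : ℤ) - (H : ℕ) = 1 := by
      rw [hH, ← hsum]
      push_cast
      rw [← Finset.sum_sub_distrib]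
      refine Finset.sum_congr rfl fun I _ => ?_
      simp only [pos, neg]
      omega
    omega
  rw [hpos] at hP1 hP2
  let A₀ : ℕ → Finset ℤ := fun i =>
    (Finset.range (n i).toNat).image (fun k : ℕ => 2 * (k : ℤ)) ∪
      (Finset.range (-n i).toNat).image (fun k : ℕ => 2 * (k : ℤ) + 1)
  let τ : Finset (Fin r) → ℤ := fun I => if 0 < n I.card then P I else Q I
  let A : Finset (Fin r) → Finset ℤ := fun I => (A₀ I.card).image (· + 2 * τ I)
  have memA : ∀ {I l}, l ∈ A I ↔ (∃ k < pos I, l = 2 * (P I + k : ℕ)) ∨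
      ∃ k < neg I, l = 2 * (Q I + k : ℕ) + 1 := by
    intro I l
    simp only [A, A₀, τ, pos, neg, Finset.mem_image, Finset.mem_union, Finset.mem_range]
    constructor
    · rintro ⟨_, ⟨k, hk, rfl⟩ | ⟨k, hk, rfl⟩, rfl⟩
      · left
        refine ⟨k, hk, ?_⟩
        rw [if_pos (by omega)]
        push_cast; ring
      · right
        refine ⟨k, hk, ?_⟩
        rw [if_neg (by omega)]
        push_cast; ring
    · rintro (⟨k, hk, rfl⟩ | ⟨k, hk, rfl⟩)
      · refine ⟨_, Or.inl ⟨k, hk, rfl⟩, ?_⟩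
        rw [if_pos (by omega)]
        push_cast; ring
      · refine ⟨_, Or.inr ⟨k, hk, rfl⟩, ?_⟩
        rw [if_neg (by omega)]
        push_cast; ring
  have hcard : ∀ i, n i ≠ 0 → ∃ I : Finset (Fin r), I.card = i := fun i hi => by
    obtain ⟨I, -, hI⟩ := Finset.exists_subset_card_eq
      (show i ≤ (Finset.univ : Finset (Fin r)).card by
        rw [Finset.card_univ, Fintype.card_fin]; have := hn i hi; omega)
    exact ⟨I, hI⟩
  refine ⟨⟨H, A, A₀, τ, ?_, ?_, ?_, ?_, ?_, ?_⟩⟩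
  · intro I J l hI hJ
    rw [memA] at hI hJ
    rcases hI with ⟨k, hk, rfl⟩ | ⟨k, hk, rfl⟩ <;> rcases hJ with ⟨k', hk', h⟩ | ⟨k', hk', h⟩
    · exact hP3 I J k hk k' hk' (by omega)
    · omega
    · omega
    · exact hQ3 I J k hk k' hk' (by omega)
  · intro l h0 hl
    lift l to ℕ using h0
    rcases Nat.even_or_odd' l with ⟨m, rfl | rfl⟩
    · obtain ⟨I, k, hk, hm⟩ := hP2 m (by omega)
      exact ⟨I, memA.2 (Or.inl ⟨k, hk, by omega⟩)⟩
    · obtain ⟨I, k, hk, hm⟩ := hQ2 m (by omega)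
      exact ⟨I, memA.2 (Or.inr ⟨k, hk, by omega⟩)⟩
  · intro I l hl
    rcases memA.1 hl with ⟨k, hk, rfl⟩ | ⟨k, hk, rfl⟩
    · have := hP1 I k hk; omega
    · have := hQ1 I k hk; omega
  · intro i l hl
    simp only [A₀, Finset.mem_image, Finset.mem_union, Finset.mem_range] at hl
    rcases hl with ⟨k, hk, rfl⟩ | ⟨k, hk, rfl⟩
    · obtain ⟨I, rfl⟩ := hcard i (by omega)
      have := hP1 I k hk; omega
    · obtain ⟨I, rfl⟩ := hcard i (by omega)
      have := hQ1 I k hk; omega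
  · intro I l
    simp [A]
  · intro I l hl
    apply hn
    intro h0
    rcases memA.1 hl with ⟨k, hk, -⟩ | ⟨k, hk, -⟩ <;> simp [pos, neg, h0] at hk

/-- The piecewise linear function interpolating the indicator of a set of integers. -/
noncomputable def intBump (A : Finset ℤ) (c : ℝ) : ℝ := ∑ l ∈ A, max 0 (1 - 4 * |c - l|)

/-- The points at distance at most `1 / 4` from a set of integers. -/
def nearInts (A : Finset ℤ) : Set ℝ := {c | ∃ l ∈ A, |c - l| ≤ 1 / 4}

/-- The sine of `π * c`, frozen outside the interval from `-1 / 2` to `2 * H + 1 / 2`. -/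
noncomputable def cutSin (H : ℕ) (c : ℝ) : ℝ :=
  Real.sin (Real.pi * max (-1 / 2) (min (2 * (H : ℝ) + 1 / 2) c))

@[fun_prop]
theorem continuous_intBump (A : Finset ℤ) : Continuous (intBump A) := by
  unfold intBump; fun_prop

@[fun_prop]
theorem continuous_cutSin (H : ℕ) : Continuous (cutSin H) := by
  unfold cutSin; fun_prop

theorem isClosed_nearInts (A : Finset ℤ) : IsClosed (nearInts A) := by
  have : nearInts A = ⋃ l ∈ A, {c : ℝ | |c - l| ≤ 1 / 4} := by
    ext c; simp [nearInts]
  rw [this]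
  exact isClosed_biUnion_finset fun l _ => isClosed_le (by fun_prop) (by fun_prop)

theorem intBump_nonneg (A : Finset ℤ) (c : ℝ) : 0 ≤ intBump A c :=
  Finset.sum_nonneg fun _ _ => le_max_left _ _

theorem mem_nearInts_of_intBump {A : Finset ℤ} {c : ℝ} (h : intBump A c ≠ 0) :
    c ∈ nearInts A := by
  obtain ⟨l, hl, h⟩ := Finset.exists_ne_zero_of_sum_ne_zero h
  refine ⟨l, hl, ?_⟩
  by_contra! hc
  exact h (max_eq_left (by linarith))

theorem intBump_intCast (A : Finset ℤ) (m : ℤ) : intBump A m = if m ∈ A then 1 else 0 := by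
  have : ∀ l : ℤ, max 0 (1 - 4 * |(m : ℝ) - l|) = if m = l then 1 else 0 := by
    intro l
    split_ifs with h
    · subst h; simp
    · apply max_eq_left
      have : (1 : ℤ) ≤ |m - l| := Int.one_le_abs (sub_ne_zero.2 h)
      have : (1 : ℝ) ≤ |(m : ℝ) - l| := by exact_mod_cast this
      linarith
  simp [intBump, this]

theorem eq_of_mem_nearInts {A : Finset ℤ} {m : ℤ} (h : (m : ℝ) ∈ nearInts A) : m ∈ A := by
  obtain ⟨l, hl, h⟩ := h
  have h2 : |m - l| < 1 := by
    have : (|m - l| : ℝ) < 1 := by linarith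
    exact_mod_cast this
  rw [Int.abs_lt_one_iff] at h2
  rwa [show m = l by omega]

theorem cutSin_eq_zero {H : ℕ} {c : ℝ} (h : cutSin H c = 0) :
    ∃ m : ℤ, 0 ≤ m ∧ m ≤ 2 * H ∧ c = m := by
  obtain ⟨n, hn⟩ := Real.sin_eq_zero_iff.1 h
  have hn : (n : ℝ) = max (-1 / 2) (min (2 * (H : ℝ) + 1 / 2) c) := by
    have := Real.pi_pos
    field_simp at hn ⊢
    linarith
  have half : ∀ k : ℤ, (n : ℝ) ≠ k + 1 / 2 := fun k hk => by
    have : (2 * n : ℝ) = 2 * k + 1 := by linarith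
    have : 2 * n = 2 * k + 1 := by exact_mod_cast this
    omega
  rcases le_total c (-1 / 2) with h1 | h1
  · rw [max_eq_left (min_le_of_right_le h1)] at hn
    exact absurd hn (by convert half (-1) using 2; norm_num)
  rcases le_total (2 * (H : ℝ) + 1 / 2) c with h2 | h2
  · rw [min_eq_left h2, max_eq_right (by have : (0 : ℝ) ≤ H := by positivity
                                         linarith)] at hn
    exact absurd hn (by convert half (2 * H) using 2; push_cast; rfl)
  · rw [min_eq_right h2, max_eq_right h1] at hn
    refine ⟨n, ?_, ?_, hn.symm⟩
    · have : (-1 : ℝ) < n := by linarith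
      have : -1 < n := by exact_mod_cast this
      omega
    · have : (n : ℝ) < 2 * H + 1 := by linarith
      have : n < 2 * H + 1 := by exact_mod_cast this
      omega

theorem cutSin_eq_one {H : ℕ} {c : ℝ} (h : 2 * (H : ℝ) + 1 / 2 ≤ c) : cutSin H c = 1 := by
  have h0 : (0 : ℝ) ≤ H := by positivity
  rw [cutSin, min_eq_left h, max_eq_right (by linarith),
    show Real.pi * (2 * (H : ℝ) + 1 / 2) = Real.pi / 2 + H * (2 * Real.pi) by ring,
    Real.sin_add_nat_mul_two_pi, Real.sin_pi_div_two]

theorem cutSin_eq_neg_one {H : ℕ} {c : ℝ} (h : c ≤ -1 / 2) : cutSin H c = -1 := by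
  rw [cutSin, max_eq_left (min_le_of_right_le h),
    show Real.pi * (-1 / 2) = -(Real.pi / 2) by ring, Real.sin_neg, Real.sin_pi_div_two]

theorem cutSin_of_mem {H : ℕ} {c : ℝ} {l : ℤ} (h0 : 0 ≤ l) (hl : l ≤ 2 * H)
    (h : |c - l| ≤ 1 / 4) : cutSin H c = Real.sin (Real.pi * c) := by
  have h0 : (0 : ℝ) ≤ l := by exact_mod_cast h0
  have hl : (l : ℝ) ≤ 2 * H := by exact_mod_cast hl
  rw [abs_le] at h
  rw [cutSin, min_eq_right (by linarith), max_eq_right (by linarith)]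

/-- Truncation to the unit interval. -/
noncomputable def unitClamp (x : ℝ) : ℝ := max 0 (min 1 x)

@[fun_prop]
theorem continuous_unitClamp : Continuous unitClamp := by
  unfold unitClamp; fun_prop

theorem unitClamp_nonneg (x : ℝ) : 0 ≤ unitClamp x := le_max_left _ _

theorem unitClamp_le_one (x : ℝ) : unitClamp x ≤ 1 := max_le zero_le_one (min_le_left _ _)

theorem unitClamp_of_nonpos {x : ℝ} (h : x ≤ 0) : unitClamp x = 0 :=
  max_eq_left (min_le_of_right_le h)

theorem unitClamp_of_one_le {x : ℝ} (h : 1 ≤ x) : unitClamp x = 1 := by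
  simp [unitClamp, min_eq_left h]

namespace SlotSystem

variable {r : ℕ} (X : SlotSystem r)

theorem intBump_shift (I : Finset (Fin r)) (c : ℝ) :
    intBump (X.A I) (c + 2 * X.τ I) = intBump (X.A₀ I.card) c := by
  have : X.A I = (X.A₀ I.card).map (addRightEmbedding (2 * X.τ I)) := by
    ext l
    simp only [Finset.mem_map, addRightEmbedding_apply]
    constructor
    · intro h
      refine ⟨l - 2 * X.τ I, (X.shift I _).1 (by simpa using h), by ring⟩
    · rintro ⟨a, ha, rfl⟩
      exact (X.shift I a).2 ha
  rw [intBump, this, Finset.sum_map, intBump]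
  refine Finset.sum_congr rfl fun l _ => ?_
  simp

/-- The displacement function of the active set `I`. -/
noncomputable def drift (I : Finset (Fin r)) (c h : ℝ) : ℝ :=
  (1 - unitClamp (3 * h - 2)) * cutSin X.H (c + 2 * unitClamp (3 * h - 1) * X.τ I) +
    unitClamp (3 * h - 2) * cutSin X.H c

/-- The cutoff parameter. -/
noncomputable def bound : ℝ := 2 * X.H + 1 + ∑ I, 2 * |(X.τ I : ℝ)|

theorem le_bound (I : Finset (Fin r)) : 2 * X.H + 1 + 2 * |(X.τ I : ℝ)| ≤ X.bound := by
  have := Finset.single_le_sum (f := fun I => 2 * |(X.τ I : ℝ)|) (fun _ _ => by positivity)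
    (Finset.mem_univ I)
  unfold bound
  linarith

theorem abs_shift_le (I : Finset (Fin r)) (x : ℝ) :
    |2 * unitClamp x * X.τ I| ≤ 2 * |(X.τ I : ℝ)| := by
  rw [abs_mul, abs_mul, abs_of_nonneg (unitClamp_nonneg x), abs_two]
  have := unitClamp_le_one x
  have := unitClamp_nonneg x
  have := abs_nonneg (X.τ I : ℝ)
  nlinarith

theorem drift_eq_zero {I : Finset (Fin r)} {c h : ℝ}
    (h1 : max (-X.bound) (min X.bound (c - X.drift I c h)) = c) : X.drift I c h = 0 := by
  have h2 := X.le_bound I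
  have h3 := abs_le.1 (X.abs_shift_le I (3 * h - 1))
  have h4 : (0 : ℝ) ≤ X.H := by positivity
  have h5 := abs_nonneg (X.τ I : ℝ)
  rcases eq_or_ne c X.bound with hL | hL
  · have : X.drift I c h = 1 := by
      rw [drift, cutSin_eq_one (by linarith), cutSin_eq_one (by linarith)]; ring
    rw [this, min_eq_right (by linarith), max_eq_right (by linarith)] at h1
    linarith
  rcases eq_or_ne c (-X.bound) with hL' | hL'
  · have : X.drift I c h = -1 := by
      rw [drift, cutSin_eq_neg_one (by linarith), cutSin_eq_neg_one (by linarith)]; ring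
    rw [this, min_eq_right (by linarith), max_eq_right (by linarith)] at h1
    linarith
  rcases max_choice (-X.bound) (min X.bound (c - X.drift I c h)) with e | e
  · exact absurd (h1.symm.trans e) hL'
  rcases min_choice X.bound (c - X.drift I c h) with e' | e'
  · exact absurd (h1.symm.trans (e.trans e')) hL
  · have := h1.symm.trans (e.trans e')
    linarith

/-- The total weight function of the active set `I`. -/
noncomputable def weight (I : Finset (Fin r)) (c h : ℝ) : ℝ :=
  intBump (X.A I) (c + 2 * unitClamp (3 * h - 1) * X.τ I) +
    unitClamp (1 - 3 * h) * ∑ J ∈ Finset.univ.erase I, intBump (X.A J) c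

theorem weight_zero (I : Finset (Fin r)) (c : ℝ) :
    X.weight I c 0 = ∑ J, intBump (X.A J) c := by
  rw [weight, unitClamp_of_nonpos (by norm_num), unitClamp_of_one_le (by norm_num),
    ← Finset.add_sum_erase _ _ (Finset.mem_univ I)]
  simp

theorem drift_zero (I : Finset (Fin r)) (c : ℝ) : X.drift I c 0 = cutSin X.H c := by
  rw [drift, unitClamp_of_nonpos (by norm_num), unitClamp_of_nonpos (by norm_num)]
  simp

theorem drift_one (I : Finset (Fin r)) (c : ℝ) : X.drift I c 1 = cutSin X.H c := by
  rw [drift, unitClamp_of_one_le (x := 3 * 1 - 2) (by norm_num)]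
  simp

theorem sum_intBump_erase {I : Finset (Fin r)} {l : ℤ} (hl : l ∈ X.A I) :
    ∑ J ∈ Finset.univ.erase I, intBump (X.A J) l = 0 := by
  refine Finset.sum_eq_zero fun J hJ => ?_
  rw [intBump_intCast, if_neg fun h => (Finset.mem_erase.1 hJ).1 (X.unique h hl)]

theorem index_unique {I J : Finset (Fin r)} {c : ℝ} (hI : c ∈ nearInts (X.A I))
    (hJ : c ∈ nearInts (X.A J)) : I = J := by
  obtain ⟨l, hl, h⟩ := hI
  obtain ⟨l', hl', h'⟩ := hJ
  have h2 : |l - l'| < 1 := by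
    have : (|l - l'| : ℝ) < 1 := by
      rw [abs_le] at h h'
      rw [abs_lt]
      constructor <;> linarith
    exact_mod_cast this
  rw [Int.abs_lt_one_iff] at h2
  rw [show l' = l by omega] at hl'
  exact X.unique hl hl'

theorem weight_eq_one {I : Finset (Fin r)} {c h : ℝ} (hd : X.drift I c h = 0)
    (hs : c + 2 * unitClamp (3 * h - 1) * X.τ I ∈ nearInts (X.A I)) : X.weight I c h = 1 := by
  rcases le_total h (2 / 3) with h23 | h23
  · rw [drift, unitClamp_of_nonpos (x := 3 * h - 2) (by linarith)] at hd
    simp only [sub_zero, one_mul, zero_mul, add_zero] at hd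
    obtain ⟨m, -, -, hm⟩ := cutSin_eq_zero hd
    rw [hm] at hs
    have hmA := eq_of_mem_nearInts hs
    rw [weight, hm, intBump_intCast, if_pos hmA]
    rcases le_total h (1 / 3) with h13 | h13
    · rw [unitClamp_of_nonpos (by linarith)] at hm
      simp only [mul_zero, zero_mul, add_zero] at hm
      rw [hm, X.sum_intBump_erase hmA]
      ring
    · rw [unitClamp_of_nonpos (x := 1 - 3 * h) (by linarith)]
      ring
  · have hone : unitClamp (3 * h - 1) = 1 := unitClamp_of_one_le (by linarith)
    rw [weight, hone, mul_one, intBump_shift, unitClamp_of_nonpos (x := 1 - 3 * h) (by linarith)]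
    rw [hone, mul_one] at hs
    obtain ⟨l, hl, hcl⟩ := hs
    have hl₀ : l - 2 * X.τ I ∈ X.A₀ I.card := (X.shift I _).1 (by simpa using hl)
    have hb := X.bounds hl
    have hb₀ := X.bounds₀ hl₀
    have hcl' : |c - (l - 2 * X.τ I : ℤ)| ≤ 1 / 4 := by
      push_cast
      convert hcl using 2
      ring
    have hzero : cutSin X.H c = 0 := by
      rw [drift, hone, mul_one, cutSin_of_mem hb.1 hb.2 hcl,
        show Real.pi * (c + 2 * X.τ I) = Real.pi * c + X.τ I * (2 * Real.pi) by ring,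
        Real.sin_add_int_mul_two_pi, ← cutSin_of_mem hb₀.1 hb₀.2 hcl'] at hd
      linarith
    obtain ⟨m, -, -, rfl⟩ := cutSin_eq_zero hzero
    rw [intBump_intCast, if_pos (eq_of_mem_nearInts ⟨_, hl₀, hcl'⟩)]
    ring

/-- The raising pattern attached to a slot system. -/
noncomputable def raisingPattern (hr : 2 ≤ r) : RaisingPattern r where
  L := X.bound
  eta I c h := max (-X.bound) (min X.bound (c - X.drift I c h))
  rho := X.weight
  etaFar c := max (-X.bound) (min X.bound (c - cutSin X.H c))
  rhoFar i := intBump (X.A₀ i)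
  side I J := {x | (J = I ∧ x.1 + 2 * unitClamp (3 * x.2 - 1) * X.τ I ∈ nearInts (X.A I)) ∨
    (J ≠ I ∧ x.2 ≤ 1 / 3 ∧ x.1 ∈ nearInts (X.A J))}
  far i := nearInts (X.A₀ i)
  L_pos := by unfold bound; positivity
  continuous_eta I := by unfold drift; fun_prop
  continuous_rho I := by unfold weight; fun_prop
  isClosed_side I J := by
    refine IsClosed.union ?_ ?_
    · exact isClosed_const.and ((isClosed_nearInts _).preimage (by fun_prop))
    · exact isClosed_const.and ((isClosed_le (by fun_prop) (by fun_prop)).and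
        ((isClosed_nearInts _).preimage (by fun_prop)))
  isClosed_far i := isClosed_nearInts _
  eta_le I c h := by
    have : 0 < X.bound := by unfold bound; positivity
    rw [abs_le]
    exact ⟨le_max_left _ _, max_le (by linarith) (min_le_left _ _)⟩
  rho_nonneg I c h := add_nonneg (intBump_nonneg _ _)
    (mul_nonneg (unitClamp_nonneg _) (Finset.sum_nonneg fun _ _ => intBump_nonneg _ _))
  eta_zero I J c := by simp only [drift_zero]
  rho_zero I J c := by simp only [weight_zero]
  eta_one I c := by simp only [drift_one]
  rho_one I c _ := by
    rw [weight, unitClamp_of_one_le (by norm_num), unitClamp_of_nonpos (by norm_num), mul_one,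
      intBump_shift]
    ring
  rho_eq_one_of_zero I c _ h := by
    have := X.drift_eq_zero h
    rw [drift_zero] at this
    obtain ⟨m, h0, h1, rfl⟩ := cutSin_eq_zero this
    obtain ⟨J, hJ⟩ := X.exists_mem h0 h1
    rw [weight_zero, ← Finset.add_sum_erase _ _ (Finset.mem_univ J), X.sum_intBump_erase hJ,
      intBump_intCast, if_pos hJ, add_zero]
  rho_eq_one I c h _ _ _ he hs := by
    refine X.weight_eq_one (X.drift_eq_zero he) ?_
    simpa using hs
  rhoFar_eq i c _ h := by
    have := X.drift_eq_zero (I := ∅) (h := 0) (by rwa [drift_zero])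
    rw [drift_zero] at this
    obtain ⟨m, -, -, rfl⟩ := cutSin_eq_zero this
    rw [intBump_intCast]
    split_ifs <;> simp
  exists_side I c h _ _ hne := by
    by_cases h1 : intBump (X.A I) (c + 2 * unitClamp (3 * h - 1) * X.τ I) = 0
    · rw [weight, h1, zero_add] at hne
      obtain ⟨J, hJ, hne2⟩ := Finset.exists_ne_zero_of_sum_ne_zero (right_ne_zero_of_mul hne)
      refine ⟨J, Or.inr ⟨(Finset.mem_erase.1 hJ).1, ?_, mem_nearInts_of_intBump hne2⟩⟩
      by_contra! hc
      exact left_ne_zero_of_mul hne (unitClamp_of_nonpos (by simp at hc ⊢; linarith))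
    · exact ⟨I, Or.inl ⟨rfl, mem_nearInts_of_intBump h1⟩⟩
  mem_far i c h := mem_nearInts_of_intBump h
  side_unique I J J' c h _ _ hJ hJ' := by
    have aux : ∀ {J}, J ≠ I → h ≤ 1 / 3 → c ∈ nearInts (X.A J) →
        c + 2 * unitClamp (3 * h - 1) * X.τ I ∈ nearInts (X.A I) → False := by
      intro J h1 h2 h3 h4
      rw [unitClamp_of_nonpos (by linarith)] at h4
      simp only [mul_zero, zero_mul, add_zero] at h4
      exact h1 (X.index_unique h3 h4)
    rcases hJ with ⟨rfl, h1⟩ | ⟨h1, h2, h3⟩ <;> rcases hJ' with ⟨rfl, h1'⟩ | ⟨h1', h2', h3'⟩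
    · rfl
    · exact (aux h1' h2' h3' h1).elim
    · exact (aux h1 h2 h3 h1').elim
    · exact X.index_unique h3 h3'
  side_zero I I' J J' c hJ hJ' := by
    have aux : ∀ {I J}, ((J = I ∧ c + 2 * unitClamp (3 * 0 - 1) * X.τ I ∈ nearInts (X.A I)) ∨
        (J ≠ I ∧ (0 : ℝ) ≤ 1 / 3 ∧ c ∈ nearInts (X.A J))) → c ∈ nearInts (X.A J) := by
      rintro I J (⟨rfl, h⟩ | ⟨-, -, h⟩)
      · rw [unitClamp_of_nonpos (by norm_num)] at h
        simpa using h
      · exact h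
    exact X.index_unique (aux hJ) (aux hJ')
  side_one I J c h := by
    rcases h with ⟨rfl, l, hl, -⟩ | ⟨-, h, -⟩
    · exact ⟨rfl, (X.card hl).2⟩
    · norm_num at h
  side_proper I J c h hs := by
    have : ∃ l, l ∈ X.A J := by
      rcases hs with ⟨rfl, l, hl, -⟩ | ⟨-, -, l, hl, -⟩ <;> exact ⟨l, hl⟩
    obtain ⟨l, hl⟩ := this
    have := X.card hl
    refine ⟨Finset.card_pos.1 (by omega), fun h => ?_⟩
    rw [h, Finset.card_univ, Fintype.card_fin] at this
    omega

end SlotSystem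

/-- A prime does not divide all proper binomial coefficients of a number that is not one of its
powers. -/
theorem exists_choose_not_dvd {r p : ℕ} (hp : p.Prime) (hr : 1 ≤ r) (h : ∀ m, r ≠ p ^ m) :
    ∃ i, 1 ≤ i ∧ i < r ∧ ¬ p ∣ r.choose i := by
  have : Fact p.Prime := ⟨hp⟩
  by_contra! hc
  refine h _ (Choose.eq_pow_multiplicity_of_choose_modEq_zero_nat (p := p) hr fun i hi => ?_)
  rw [Finset.mem_Icc] at hi
  exact (Nat.modEq_zero_iff_dvd).2 (hc i hi.1 (by omega))

theorem exists_weights {r : ℕ} (hr : 2 ≤ r) (hnp : ¬ ∃ q m : ℕ, q.Prime ∧ 1 ≤ m ∧ r = q ^ m) :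
    ∃ n : ℕ → ℤ, (∀ i, n i ≠ 0 → 1 ≤ i ∧ 2 * i ≤ r) ∧ ∑ I : Finset (Fin r), n I.card = 1 := by
  let s : Finset ℕ := Finset.Icc 1 (r / 2)
  have hg : s.gcd (fun i => (r.choose i : ℤ)) = 1 := by
    rw [← Finset.normalize_gcd, normalize_eq_one]
    by_contra hu
    rw [Int.isUnit_iff_natAbs_eq] at hu
    obtain ⟨p, hp, hpd⟩ := Nat.exists_prime_and_dvd hu
    obtain ⟨i, h1, h2, h3⟩ := exists_choose_not_dvd hp (by omega) (r := r) fun m hm => hnp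
      ⟨p, m, hp, by
        rcases m with _ | m
        · simp at hm; omega
        · omega, hm⟩
    have hall : ∀ i ∈ s, p ∣ r.choose i := fun i hi => by
      have := (Int.natCast_dvd.2 hpd).trans (Finset.gcd_dvd hi)
      exact_mod_cast this
    rcases le_total (2 * i) r with h | h
    · exact h3 (hall i (Finset.mem_Icc.2 (by omega)))
    · rw [← Nat.choose_symm h2.le] at h3
      exact h3 (hall _ (Finset.mem_Icc.2 (by omega)))
  obtain ⟨g, hg'⟩ := s.gcd_eq_sum_mul fun i => (r.choose i : ℤ)
  rw [hg] at hg'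
  refine ⟨fun i => if i ∈ s then g i else 0, fun i hi => ?_, ?_⟩
  · have : i ∈ s := by by_contra h; simp [h] at hi
    rw [Finset.mem_Icc] at this
    omega
  · rw [← Finset.powerset_univ, Finset.sum_powerset_apply_card (fun i => if i ∈ s then g i else 0),
      Finset.card_univ, Fintype.card_fin, hg']
    refine (Finset.sum_subset_zero_on_sdiff (s₁ := s) ?_ ?_ ?_).symm
    · intro i hi
      rw [Finset.mem_Icc] at hi
      rw [Finset.mem_range]; omega
    · intro i hi
      rw [if_neg (Finset.mem_sdiff.1 hi).2, smul_zero]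
    · intro i hi
      rw [if_pos hi, nsmul_eq_mul]

/-- A set of positive Hausdorff codimension. -/
def Negligible {E : Type*} [NormedAddCommGroup E] [NormedSpace ℝ E] (B : Set E) : Prop :=
  dimH B + 1 ≤ Module.finrank ℝ E

section
variable {E : Type*} [NormedAddCommGroup E] [NormedSpace ℝ E]

theorem Negligible.mono {B B' : Set E} (h : Negligible B') (hs : B ⊆ B') : Negligible B :=
  (add_le_add_left (dimH_mono hs) 1).trans h

theorem Negligible.iUnion {ι : Sort*} [Countable ι] [Nonempty ι] {B : ι → Set E}
    (h : ∀ i, Negligible (B i)) : Negligible (⋃ i, B i) := by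
  rw [Negligible, dimH_iUnion, ENNReal.iSup_add]
  exact iSup_le h

theorem Negligible.iUnion_of_finrank_pos {ι : Sort*} [Countable ι]
    (hE : 0 < Module.finrank ℝ E) {B : ι → Set E} (h : ∀ i, Negligible (B i)) :
    Negligible (⋃ i, B i) := by
  rcases isEmpty_or_nonempty ι with _ | _
  · simpa [Negligible] using Nat.succ_le_of_lt hE
  · exact .iUnion h

theorem Negligible.union {B B' : Set E} (h : Negligible B) (h' : Negligible B') :
    Negligible (B ∪ B') := by
  rw [union_eq_iUnion]
  exact .iUnion (by rintro (_ | _) <;> assumption)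

theorem Negligible.dense_compl [FiniteDimensional ℝ E] {B : Set E} (h : Negligible B) :
    Dense Bᶜ := by
  refine dense_compl_of_dimH_lt_finrank (lt_of_lt_of_le ?_ h)
  refine ENNReal.lt_add_right ?_ one_ne_zero
  intro ht
  rw [Negligible, ht, top_add, top_le_iff] at h
  exact ENNReal.natCast_ne_top _ h

end

/-- A family of linear equations over a parameter space of smaller dimension than the number of
equations has solutions only in a negligible set. -/
theorem negligible_of_surjective {P Θ Y : Type*} [NormedAddCommGroup P] [NormedSpace ℝ P]
    [FiniteDimensional ℝ P] [NormedAddCommGroup Θ] [NormedSpace ℝ Θ] [FiniteDimensional ℝ Θ]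
    [NormedAddCommGroup Y] [NormedSpace ℝ Y] [FiniteDimensional ℝ Y]
    {A : P → Θ →L[ℝ] Y} {b : P → Y} (hA : ContDiff ℝ 1 A) (hb : ContDiff ℝ 1 b) {Ω : Set P}
    (hs : ∀ x ∈ Ω, Function.Surjective (A x))
    (hd : Module.finrank ℝ P < Module.finrank ℝ Y) (hΘ : 0 < Module.finrank ℝ Θ) :
    Negligible {θ | ∃ x ∈ Ω, A x θ = b x} := by
  rcases Ω.eq_empty_or_nonempty with rfl | hΩ
  · simpa [Negligible] using Nat.succ_le_of_lt hΘ
  have : CompleteSpace Y := FiniteDimensional.complete ℝ Y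
  have : SecondCountableTopology P :=
    (Module.finBasis ℝ P).equivFunL.toHomeomorph.secondCountableTopology
  have local_bound : ∀ x₀ ∈ Ω, ∃ U ∈ 𝓝 x₀, Negligible {θ | ∃ x ∈ U, A x θ = b x} := by
    intro x₀ hx₀
    obtain ⟨B, hB⟩ := (A x₀ : Θ →ₗ[ℝ] Y).exists_rightInverse_of_surjective
      (LinearMap.range_eq_top.2 (hs x₀ hx₀))
    set B₀ : Y →L[ℝ] Θ := LinearMap.toContinuousLinearMap B
    have hAB : (A x₀).comp B₀ = ContinuousLinearMap.id ℝ Y := by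
      ext y; exact LinearMap.congr_fun hB y
    have hcont : Continuous fun x => (A x).comp B₀ := by
      have := hA.continuous
      fun_prop
    have hU : ∀ᶠ x in 𝓝 x₀, (A x).comp B₀ ∈ range ((↑) : (Y ≃L[ℝ] Y) → (Y →L[ℝ] Y)) := by
      refine hcont.continuousAt.eventually (ContinuousLinearEquiv.isOpen.mem_nhds ?_)
      beta_reduce
      rw [hAB]
      exact ⟨ContinuousLinearEquiv.refl ℝ Y, rfl⟩
    refine ⟨_, hU, ?_⟩
    set U := {x | (A x).comp B₀ ∈ range ((↑) : (Y ≃L[ℝ] Y) → (Y →L[ℝ] Y))}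
    let k := LinearMap.ker (A x₀ : Θ →ₗ[ℝ] Y)
    let ψ : P × k → Θ := fun x =>
      x.2 + B₀ (ContinuousLinearMap.inverse ((A x.1).comp B₀) (b x.1 - A x.1 x.2))
    have hψ : ∀ x ∈ U ×ˢ (univ : Set k), ContDiffAt ℝ 1 ψ x := by
      rintro ⟨x, κ⟩ ⟨⟨e, he⟩, -⟩
      have h1 : ContDiffAt ℝ 1 (fun x : P × k => ContinuousLinearMap.inverse ((A x.1).comp B₀))
          (x, κ) := by
        have h2 : ContDiffAt ℝ 1 (ContinuousLinearMap.inverse (R := ℝ) (M := Y) (M₂ := Y))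
            ((A x).comp B₀) := he ▸ contDiffAt_map_inverse e
        exact ContDiffAt.comp (f := fun x : P × k => (A x.1).comp B₀) (x, κ) h2 <|
         ContDiff.contDiffAt ((hA.comp contDiff_fst).clm_comp contDiff_const)
      have h3 : ContDiff ℝ 1 (fun x : P × k => b x.1 - A x.1 x.2) := by
        refine (hb.comp contDiff_fst).sub ((hA.comp contDiff_fst).clm_apply ?_)
        exact k.subtypeL.contDiff.comp contDiff_snd
      refine ContDiffAt.add (k.subtypeL.contDiff.comp contDiff_snd).contDiffAt ?_
      exact B₀.contDiff.contDiffAt.comp _ (h1.clm_apply h3.contDiffAt)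
    have hsub : {θ | ∃ x ∈ U, A x θ = b x} ⊆ ψ '' (U ×ˢ univ) := by
      rintro θ ⟨x, hx, hθ⟩
      refine ⟨(x, ⟨θ - B₀ (A x₀ θ), ?_⟩), ⟨hx, mem_univ _⟩, ?_⟩
      · have := DFunLike.congr_fun hAB (A x₀ θ)
        simp only [ContinuousLinearMap.comp_apply, ContinuousLinearMap.id_apply] at this
        simp [k, this]
      · obtain ⟨e, he⟩ := hx
        have h1 : b x - A x (θ - B₀ (A x₀ θ)) = e (A x₀ θ) := by
          have := DFunLike.congr_fun he (A x₀ θ)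
          simp only [ContinuousLinearMap.comp_apply] at this
          rw [map_sub, hθ, ← this]
          simp
        simp only [ψ]
        rw [h1, ← he, ContinuousLinearMap.inverse_equiv]
        simp
    have hrank : Module.finrank ℝ (P × k) + 1 ≤ Module.finrank ℝ Θ := by
      have h1 := LinearMap.finrank_range_add_finrank_ker (A x₀ : Θ →ₗ[ℝ] Y)
      rw [LinearMap.range_eq_top.2 (hs x₀ hx₀), finrank_top] at h1
      rw [Module.finrank_prod]
      change _ + Module.finrank ℝ k = _ at h1
      omega
    refine Negligible.mono ?_ hsub
    have h1 : dimH (ψ '' (U ×ˢ univ)) ≤ dimH (U ×ˢ (univ : Set k)) := by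
      refine dimH_image_le_of_locally_lipschitzOn fun x hx => ?_
      obtain ⟨C, s, hs, hC⟩ := (hψ x hx).exists_lipschitzOnWith
      exact ⟨C, s, mem_nhdsWithin_of_mem_nhds hs, hC⟩
    have h2 : dimH (U ×ˢ (univ : Set k)) ≤ Module.finrank ℝ (P × k) :=
      (dimH_mono (subset_univ _)).trans (Real.dimH_univ_eq_finrank (P × k)).le
    calc dimH (ψ '' (U ×ˢ univ)) + 1 ≤ (Module.finrank ℝ (P × k) : ENNReal) + 1 := by
          gcongr; exact h1.trans h2
      _ ≤ Module.finrank ℝ Θ := by exact_mod_cast hrank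
  choose! U hU hB using local_bound
  obtain ⟨t, ht, htc, htU⟩ := TopologicalSpace.countable_cover_nhdsWithin
    (fun x hx => mem_nhdsWithin_of_mem_nhds (hU x hx))
  have : Countable t := htc
  have : Nonempty t := by
    obtain ⟨x, hx⟩ := hΩ
    obtain ⟨y, hy, -⟩ := mem_iUnion₂.1 (htU hx)
    exact ⟨⟨y, hy⟩⟩
  refine Negligible.mono (B' := ⋃ x : t, {θ | ∃ y ∈ U x, A y θ = b y})
    (.iUnion fun x => hB _ (ht x.2)) ?_
  rintro θ ⟨x, hx, hθ⟩
  obtain ⟨y, hy, hxy⟩ := mem_iUnion₂.1 (htU hx)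
  exact mem_iUnion.2 ⟨⟨y, hy⟩, x, hxy, hθ⟩

/-- Functions on `Fin n → ℝ` interpolating arbitrary values at up to `N` points. -/
noncomputable def interpFun (N n : ℕ) (i : Fin (N * N * n + 1) × Fin N) (x : Fin n → ℝ) : ℝ :=
  (∑ v, x v * (i.1 : ℝ) ^ (v : ℕ)) ^ (i.2 : ℕ)

@[fun_prop]
theorem contDiff_interpFun {N n : ℕ} (i : Fin (N * N * n + 1) × Fin N) :
    ContDiff ℝ 1 (interpFun N n i) := by
  unfold interpFun; fun_prop

theorem exists_separating_power_sum {J : Type*} [Fintype J] {N n : ℕ} (hJ : Fintype.card J ≤ N)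
    {x : J → Fin n → ℝ} (hx : Function.Injective x) :
    ∃ s : Fin (N * N * n + 1), Function.Injective fun j => ∑ v, x j v * (s : ℝ) ^ (v : ℕ) := by
  classical
  let p : J × J → Polynomial ℝ := fun j =>
    ∑ v : Fin n, Polynomial.C (x j.1 v - x j.2 v) * Polynomial.X ^ (v : ℕ)
  have hp : ∀ j ∈ Finset.univ.offDiag, p j ≠ 0 := by
    rintro ⟨j, k⟩ hjk h0
    refine (Finset.mem_offDiag.1 hjk).2.2 (hx (funext fun v => ?_))
    have := congrArg (fun q => Polynomial.coeff q (v : ℕ)) h0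
    simp only [p, Polynomial.finsetSum_coeff, Polynomial.coeff_C_mul, Polynomial.coeff_X_pow,
      Fin.val_inj, mul_ite, mul_one, mul_zero, Finset.sum_ite_eq, Finset.mem_univ, if_true,
      Polynomial.coeff_zero] at this
    linarith
  have hdeg : ∀ j, (p j).natDegree ≤ n := fun j =>
    Polynomial.natDegree_sum_le_of_forall_le _ _ fun v _ =>
      (Polynomial.natDegree_C_mul_X_pow_le _ _).trans v.2.le
  let q := ∏ j ∈ Finset.univ.offDiag, p j
  have hq : q ≠ 0 := Finset.prod_ne_zero_iff.2 hp
  have hqdeg : q.natDegree < N * N * n + 1 := by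
    have h1 : q.natDegree ≤ ∑ j ∈ (Finset.univ : Finset J).offDiag, n :=
      (Polynomial.natDegree_prod_le _ _).trans (Finset.sum_le_sum fun j _ => hdeg j)
    rw [Finset.sum_const, Finset.offDiag_card, smul_eq_mul, Finset.card_univ] at h1
    have h2 : Fintype.card J * Fintype.card J - Fintype.card J ≤ N * N :=
      (Nat.sub_le _ _).trans (Nat.mul_le_mul hJ hJ)
    have := Nat.mul_le_mul_right n h2
    omega
  obtain ⟨s, hs⟩ : ∃ s : Fin (N * N * n + 1), q.eval (s : ℝ) ≠ 0 := by
    by_contra! hc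
    refine hq (Polynomial.eq_zero_of_natDegree_lt_card_of_eval_eq_zero q
      (f := fun s : Fin (N * N * n + 1) => ((s : ℕ) : ℝ)) ?_ hc (by simpa using hqdeg))
    exact Nat.cast_injective.comp Fin.val_injective
  refine ⟨s, fun j k hjk => ?_⟩
  by_contra hne
  refine hs ?_
  rw [Polynomial.eval_prod]
  refine Finset.prod_eq_zero (i := (j, k)) (by simp [hne]) ?_
  simp only [p, Polynomial.eval_finsetSum, Polynomial.eval_mul, Polynomial.eval_C,
    Polynomial.eval_pow, Polynomial.eval_X, sub_mul, Finset.sum_sub_distrib]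
  exact sub_eq_zero.2 hjk

theorem exists_interpolation {J Y : Type*} [Fintype J] [AddCommGroup Y] [Module ℝ Y] {N n : ℕ}
    (hJ : Fintype.card J ≤ N) {x : J → Fin n → ℝ} (hx : Function.Injective x) (y : J → Y) :
    ∃ θ : Fin (N * N * n + 1) × Fin N → Y, ∀ j, ∑ i, interpFun N n i (x j) • θ i = y j := by
  classical
  obtain ⟨s, hs⟩ := exists_separating_power_sum hJ hx
  set ν : J → ℝ := fun j => ∑ v, x j v * (s : ℝ) ^ (v : ℕ)
  let B : J → Polynomial ℝ := fun j => Lagrange.basis Finset.univ ν j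
  have hB : ∀ j, (B j).natDegree < N := fun j => by
    have : 0 < Fintype.card J := Fintype.card_pos_iff.2 ⟨j⟩
    rw [Polynomial.natDegree_eq_of_degree_eq_some
      (Lagrange.degree_basis hs.injOn (Finset.mem_univ j)), Finset.card_univ]
    omega
  refine ⟨fun i => if i.1 = s then ∑ j, (B j).coeff i.2 • y j else 0, fun k => ?_⟩
  rw [Fintype.sum_prod_type, Finset.sum_eq_single s (fun b _ hb => by simp [hb]) (by simp)]
  simp only [if_true, Finset.smul_sum, smul_smul, interpFun]
  rw [Finset.sum_comm]
  have : ∀ j, ∑ i : Fin N, (∑ v, x k v * (s : ℝ) ^ (v : ℕ)) ^ (i : ℕ) * (B j).coeff i =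
      if k = j then 1 else 0 := by
    intro j
    have h1 := Polynomial.eval_eq_sum_range' (hB j) (ν k)
    rw [Finset.sum_range fun i => (B j).coeff i * ν k ^ i] at h1
    simp only [mul_comm ((B j).coeff _)] at h1
    rw [← h1]
    split_ifs with h
    · rw [h]
      exact Lagrange.eval_basis_self hs.injOn (Finset.mem_univ j)
    · exact Lagrange.eval_basis_of_ne (Ne.symm h) (Finset.mem_univ k)
  simp only [← Finset.sum_smul, this, ite_smul, one_smul, zero_smul, Finset.sum_ite_eq,
    Finset.mem_univ, if_true]

/-- The affine parametrization of the affine span of given vertices. -/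
noncomputable def faceChart {n k : ℕ} (τ : Fin (k + 1) → Fin n) (y : Fin k → ℝ) : Fin n → ℝ :=
  Pi.single (τ 0) 1 + ∑ i, y i • (Pi.single (τ i.succ) 1 - Pi.single (τ 0) 1)

/-- The points of the affine hyperplane of barycentric coordinates lying in the affine span of
`k + 1` vertices. -/
def flats (n k : ℕ) : Set (Fin n → ℝ) :=
  {x | ∑ v, x v = 1 ∧ (Finset.univ.filter fun v => x v ≠ 0).card ≤ k + 1}

@[fun_prop]
theorem contDiff_faceChart {n k : ℕ} (τ : Fin (k + 1) → Fin n) :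
    ContDiff ℝ 1 (faceChart τ) := by
  unfold faceChart; fun_prop

theorem exists_faceChart_eq {n k : ℕ} (hk : k + 1 ≤ n) {x : Fin n → ℝ} (hx : x ∈ flats n k) :
    ∃ (τ : Fin (k + 1) → Fin n) (y : Fin k → ℝ), faceChart τ y = x := by
  obtain ⟨s, hs, hc⟩ := Finset.exists_superset_card_eq hx.2 (by simpa using hk)
  let e : Fin (k + 1) ≃ s := (s.equivFinOfCardEq hc).symm
  have hzero : ∀ v, v ∉ s → x v = 0 := fun v hv => by
    by_contra h
    exact hv (hs (by simp [h]))
  have h1 : ∑ i, x (e i) = 1 := by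
    rw [← hx.1, e.sum_comp fun v : s => x v, Finset.sum_coe_sort s x]
    exact Finset.sum_subset (Finset.subset_univ _) fun v _ hv => hzero v hv
  have h2 : x = ∑ i, x (e i) • (Pi.single (e i : Fin n) 1 : Fin n → ℝ) := by
    rw [e.sum_comp fun v : s => x v • (Pi.single (v : Fin n) 1 : Fin n → ℝ),
      Finset.sum_coe_sort s fun v => x v • (Pi.single v 1 : Fin n → ℝ),
      Finset.sum_subset (Finset.subset_univ s) fun v _ hv => by simp [hzero v hv]]
    ext v
    simp [Pi.single_apply]
  refine ⟨fun i => e i, fun i => x (e i.succ), ?_⟩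
  rw [Fin.sum_univ_succ] at h1 h2
  rw [faceChart]
  simp only [smul_sub, Finset.sum_sub_distrib, ← Finset.sum_smul]
  conv_rhs => rw [h2]
  rw [← eq_sub_iff_add_eq] at h1
  rw [h1, sub_smul, one_smul]
  abel

section

variable {Y : Type*} [NormedAddCommGroup Y] [NormedSpace ℝ Y]

/-- A perturbation of a linear map by interpolating functions. -/
noncomputable def perturb (N : ℕ) {n : ℕ} (G : (Fin n → ℝ) →L[ℝ] Y)
    (θ : Fin (N * N * n + 1) × Fin N → Y) (x : Fin n → ℝ) : Y :=
  G x + ∑ i, interpFun N n i x • θ i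

theorem negligible_perturb_charts [FiniteDimensional ℝ Y] {N n : ℕ} (G : (Fin n → ℝ) →L[ℝ] Y)
    {J L : Type*} [Fintype J] [NormedAddCommGroup L] [NormedSpace ℝ L] [FiniteDimensional ℝ L]
    (hJ : Fintype.card J ≤ N) (k : J → ℕ) (τ : ∀ j, Fin (k j + 1) → Fin n) {F : L → J → Y}
    (hF : ContDiff ℝ 1 F)
    (hd : ∑ j, k j + Module.finrank ℝ L < Fintype.card J * Module.finrank ℝ Y) :
    Negligible {θ | ∃ (y : ∀ j, Fin (k j) → ℝ) (l : L),
      Function.Injective (fun j => faceChart (τ j) (y j)) ∧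
        ∀ j, perturb N G θ (faceChart (τ j) (y j)) = F l j} := by
  let Θ := Fin (N * N * n + 1) × Fin N → Y
  let A : (∀ j, Fin (k j) → ℝ) × L → Θ →L[ℝ] (J → Y) := fun x => ContinuousLinearMap.pi fun j =>
    ∑ i, interpFun N n i (faceChart (τ j) (x.1 j)) • ContinuousLinearMap.proj i
  have hA' : ∀ x θ j, A x θ j = ∑ i, interpFun N n i (faceChart (τ j) (x.1 j)) • θ i := by
    intro x θ j
    simp only [A, ContinuousLinearMap.coe_pi', sum_apply, smul_apply]
    rfl
  have hchart : ∀ j, ContDiff ℝ 1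
      fun x : (∀ j, Fin (k j) → ℝ) × L => faceChart (τ j) (x.1 j) := fun j =>
    (contDiff_faceChart (τ j)).comp (contDiff_pi.1 contDiff_fst j)
  have hA : ContDiff ℝ 1 A := by
    rw [contDiff_clm_apply_iff]
    intro θ
    rw [contDiff_pi]
    intro j
    simp only [hA']
    exact ContDiff.sum fun i _ =>
      ((contDiff_interpFun i).comp (hchart j)).smul contDiff_const
  have hb : ContDiff ℝ 1 fun (x : (∀ j, Fin (k j) → ℝ) × L) j => F x.2 j - G (faceChart (τ j) (x.1 j)) := by
    rw [contDiff_pi] at hF ⊢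
    intro j
    exact ((hF j).comp contDiff_snd).sub (G.contDiff.comp (hchart j))
  have hpos : 0 < Fintype.card J ∧ 0 < Module.finrank ℝ Y := by
    constructor <;> by_contra! h0 <;> simp_all
  refine (negligible_of_surjective hA hb
    (Ω := {x | Function.Injective fun j => faceChart (τ j) (x.1 j)}) ?_ ?_ ?_).mono ?_
  · rintro ⟨y, l⟩ hx w
    obtain ⟨θ, hθ⟩ := exists_interpolation hJ hx w
    refine ⟨θ, funext fun j => ?_⟩
    rw [← hθ j, hA']
  · rw [Module.finrank_prod, Module.finrank_pi_fintype, Module.finrank_pi_fintype]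
    simpa using hd
  · rw [Module.finrank_pi_fintype]
    have : 0 < N := hpos.1.trans_le hJ
    simp only [Finset.sum_const, Finset.card_univ, Fintype.card_prod, Fintype.card_fin,
      smul_eq_mul]
    exact Nat.mul_pos (Nat.mul_pos (Nat.succ_pos _) this) hpos.2
  · rintro θ ⟨y, l, hi, h⟩
    refine ⟨(y, l), hi, funext fun j => ?_⟩
    rw [← h j, perturb, hA', add_sub_cancel_left]

/-- For generic perturbations, distinct points of prescribed flats do not take values in a family
with too few parameters. -/
theorem negligible_perturb [FiniteDimensional ℝ Y] {N n : ℕ} (G : (Fin n → ℝ) →L[ℝ] Y)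
    {J L : Type*} [Fintype J] [NormedAddCommGroup L] [NormedSpace ℝ L] [FiniteDimensional ℝ L]
    (hJ : Fintype.card J ≤ N) (k : J → ℕ) (hk : ∀ j, k j + 1 ≤ n) {F : L → J → Y}
    (hF : ContDiff ℝ 1 F)
    (hd : ∑ j, k j + Module.finrank ℝ L < Fintype.card J * Module.finrank ℝ Y) :
    Negligible {θ | ∃ (x : J → Fin n → ℝ) (l : L), Function.Injective x ∧
      (∀ j, x j ∈ flats n (k j)) ∧ ∀ j, perturb N G θ (x j) = F l j} := by
  have : Nonempty (∀ j, Fin (k j + 1) → Fin n) := ⟨fun j i => ⟨0, by have := hk j; omega⟩⟩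
  refine (Negligible.iUnion fun τ => negligible_perturb_charts G hJ k τ hF hd).mono ?_
  rintro θ ⟨x, l, hi, hx, h⟩
  choose τ y hτ using fun j => exists_faceChart_eq (hk j) (hx j)
  refine mem_iUnion.2 ⟨τ, y, l, ?_, ?_⟩
  · simpa only [hτ] using hi
  · simpa only [hτ] using h

end

section

variable {N n M : ℕ} (G : (Fin n → ℝ) →L[ℝ] (Fin M → ℝ) × ℝ × ℝ)

theorem negligible_heights {J : Type*} [Fintype J] (hJ : Fintype.card J ≤ N) (k : J → ℕ)
    (hk : ∀ j, k j + 1 ≤ n) {q : ℕ} (α : J → Fin q → ℝ) (γ : J → ℝ)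
    (hd : ∑ j, k j + M + q < Fintype.card J * (M + 1)) :
    Negligible {θ | ∃ (x : J → Fin n → ℝ) (p : Fin M → ℝ) (s : Fin q → ℝ), Function.Injective x ∧
      (∀ j, x j ∈ flats n (k j)) ∧ ∀ j, (perturb N G θ (x j)).1 = p ∧
        (perturb N G θ (x j)).2.1 = ∑ i, s i * α j i + γ j} := by
  refine (negligible_perturb G (L := (Fin M → ℝ) × (Fin q → ℝ) × (J → ℝ)) hJ k hk
    (F := fun l j => (l.1, ∑ i, l.2.1 i * α j i + γ j, l.2.2 j)) ?_ ?_).mono ?_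
  · rw [contDiff_pi]
    intro j
    fun_prop
  · simp only [Module.finrank_prod, Module.finrank_fintype_fun_eq_card, Fintype.card_fin,
      Module.finrank_self]
    linarith
  · rintro θ ⟨x, p, s, hi, hx, h⟩
    refine ⟨x, (p, s, fun j => (perturb N G θ (x j)).2.2), hi, hx, fun j => ?_⟩
    exact Prod.ext (h j).1 (Prod.ext (h j).2 rfl)

theorem negligible_equal_slopes {J : Type*} [Fintype J] [DecidableEq J] (hJ : Fintype.card J ≤ N)
    {k : ℕ} (hk : k + 1 ≤ n) {i i' : J} (hne : i ≠ i')
    (hd : Fintype.card J * k + M < Fintype.card J * (M + 1)) :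
    Negligible {θ | ∃ (x : J → Fin n → ℝ) (p : Fin M → ℝ) (b : ℝ), Function.Injective x ∧
      (∀ j, x j ∈ flats n k) ∧ (∀ j, (perturb N G θ (x j)).1 = p ∧
        (perturb N G θ (x j)).2.1 = b) ∧
        (perturb N G θ (x i)).2.2 = (perturb N G θ (x i')).2.2} := by
  have hm : ∀ j, (if j = i' then i else j) ≠ i' := fun j => by split_ifs <;> assumption
  refine (negligible_perturb G (L := (Fin M → ℝ) × ℝ × ({j // j ≠ i'} → ℝ)) hJ (fun _ => k)
    (fun _ => hk) (F := fun l j => (l.1, l.2.1, l.2.2 ⟨_, hm j⟩)) ?_ ?_).mono ?_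
  · rw [contDiff_pi]
    intro j
    fun_prop
  · have : Fintype.card {j // j ≠ i'} + 1 = Fintype.card J := by
      have : 0 < Fintype.card J := Fintype.card_pos_iff.2 ⟨i⟩
      simp [Fintype.card_subtype_compl]
      omega
    simp only [Module.finrank_prod, Module.finrank_fintype_fun_eq_card, Fintype.card_fin,
      Module.finrank_self, Finset.sum_const, Finset.card_univ, smul_eq_mul]
    linarith
  · rintro θ ⟨x, p, b, hi, hx, h, hu⟩
    refine ⟨x, (p, b, fun j => (perturb N G θ (x j)).2.2), hi, hx, fun j => ?_⟩
    refine Prod.ext (h j).1 (Prod.ext (h j).2 ?_)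
    dsimp only
    split_ifs with hj
    · rw [hj, hu]
    · rfl

theorem negligible_two_slopes {J A : Type*} [Fintype J] [Fintype A]
    (hJ : Fintype.card J ≤ N) {k : ℕ} (hk : k + 1 ≤ n) {a a' : A → J}
    (ha : Function.Injective a) (ha' : Function.Injective a')
    (hu : ∀ j, j ∈ range a ∨ j ∈ range a') (I I' : Set A) [DecidablePred (· ∈ I)]
    [DecidablePred (· ∈ I')] (hM : M = k + 1) (hA : k + 7 < 3 * Fintype.card A) :
    Negligible {θ | ∃ (x : J → Fin n → ℝ) (p : Fin M → ℝ) (c h b c' h' b' : ℝ),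
      Function.Injective x ∧ (∀ j, x j ∈ flats n k) ∧ c ≠ c' ∧
      (∀ j, (perturb N G θ (x j)).1 = p) ∧
      (∀ i, (perturb N G θ (x (a i))).2.1 + c * (perturb N G θ (x (a i))).2.2 +
        (if i ∈ I then h else 0) = b) ∧
      ∀ i, (perturb N G θ (x (a' i))).2.1 + c' * (perturb N G θ (x (a' i))).2.2 +
        (if i ∈ I' then h' else 0) = b'} := by
  classical
  let ε : J → ℝ := fun j => if j ∈ a '' I then 1 else 0
  let ε' : J → ℝ := fun j => if j ∈ a' '' I' then 1 else 0
  let U := {j // ¬ (j ∈ range a ∧ j ∈ range a')}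
  let u : (Fin M → ℝ) × (Fin 6 → ℝ) × (U → ℝ) → J → ℝ := fun l j =>
    if h : j ∈ range a ∧ j ∈ range a' then l.2.1 3 - ε j * l.2.1 4 + ε' j * l.2.1 5
    else l.2.2 ⟨j, h⟩
  have hucont : ∀ j, ContDiff ℝ 1 fun l => u l j := fun j => by
    by_cases h : j ∈ range a ∧ j ∈ range a'
    · simp only [u, dif_pos h]
      fun_prop
    · simp only [u, dif_neg h]
      fun_prop
  refine (negligible_perturb G (L := (Fin M → ℝ) × (Fin 6 → ℝ) × (U → ℝ)) hJ (fun _ => k)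
    (fun _ => hk) (F := fun l j => (l.1,
      if j ∈ range a then l.2.1 1 - ε j * (l.2.1 4 * l.2.1 2) - l.2.1 0 * u l j else
        (l.2.1 1 - l.2.1 3 * l.2.1 2) - ε' j * (l.2.1 5 * l.2.1 2) -
          (l.2.1 0 - l.2.1 2) * u l j, u l j)) ?_ ?_).mono ?_
  · rw [contDiff_pi]
    intro j
    have := hucont j
    split_ifs <;> fun_prop
  · have h1 : (Finset.univ.image a).card = Fintype.card A := Finset.card_image_of_injective _ ha
    have h2 : (Finset.univ.image a').card = Fintype.card A := Finset.card_image_of_injective _ ha'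
    have h3 := Finset.card_union_add_card_inter (Finset.univ.image a) (Finset.univ.image a')
    have h4 : Finset.univ.image a ∪ Finset.univ.image a' = Finset.univ := by
      rw [Finset.eq_univ_iff_forall]
      intro j
      simpa [mem_range] using hu j
    have h5 : Fintype.card U + (Finset.univ.image a ∩ Finset.univ.image a').card =
        Fintype.card J := by
      rw [← Finset.card_compl_add_card (Finset.univ.image a ∩ Finset.univ.image a')]
      congr 1
      refine Fintype.card_of_subtype _ fun j => ?_
      simp only [Finset.mem_compl, Finset.mem_inter, Finset.mem_image, Finset.mem_univ, true_and,
        mem_range]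
    have h6 : (Finset.univ.image a ∩ Finset.univ.image a').card ≤ Fintype.card A :=
      h1 ▸ Finset.card_le_card Finset.inter_subset_left
    rw [h4, Finset.card_univ] at h3
    simp only [Module.finrank_prod, Module.finrank_fintype_fun_eq_card, Fintype.card_fin,
      Module.finrank_self, Finset.sum_const, Finset.card_univ, smul_eq_mul, hM]
    rw [show Fintype.card J * (k + 1 + (1 + 1)) = Fintype.card J * k + 3 * Fintype.card J by ring]
    omega
  · rintro θ ⟨x, p, c, h, b, c', h', b', hi, hx, hc, hp, h1, h2⟩
    have hδ : c - c' ≠ 0 := sub_ne_zero.2 hc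
    let w := fun j => (perturb N G θ (x j)).2.2
    let s : Fin 6 → ℝ := ![c, b, c - c', (b - b') / (c - c'), h / (c - c'), h' / (c - c')]
    have e1 : ∀ j ∈ range a, (perturb N G θ (x j)).2.1 + c * w j + ε j * h = b := by
      rintro _ ⟨i, rfl⟩
      have := h1 i
      simp only [ε, ha.mem_set_image, ite_mul, one_mul, zero_mul]
      exact this
    have e2 : ∀ j ∈ range a', (perturb N G θ (x j)).2.1 + c' * w j + ε' j * h' = b' := by
      rintro _ ⟨i, rfl⟩
      have := h2 i
      simp only [ε', ha'.mem_set_image, ite_mul, one_mul, zero_mul]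
      exact this
    have e3 : ∀ j, u (p, s, fun j => w j) j = w j := by
      intro j
      simp only [u]
      split_ifs with hj
      · have g1 := e1 j hj.1
        have g2 := e2 j hj.2
        simp only [s, Matrix.cons_val]
        field_simp
        linarith
      · rfl
    refine ⟨x, (p, s, fun j => w j), hi, hx, fun j => ?_⟩
    refine Prod.ext (hp j) (Prod.ext ?_ (e3 j).symm)
    dsimp only
    rw [e3]
    simp only [s, Matrix.cons_val]
    split_ifs with hj
    · have g1 := e1 j hj
      rw [div_mul_cancel₀ _ hδ]
      linarith
    · have g2 := e2 j ((hu j).resolve_left hj)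
      rw [div_mul_cancel₀ _ hδ, div_mul_cancel₀ _ hδ]
      linarith

end

/-- The points of the standard simplex with at most `k + 1` nonzero coordinates. -/
def simplexSkeleton (n k : ℕ) : Set (Fin n → ℝ) := stdSimplex ℝ (Fin n) ∩ flats n k

theorem isClosed_card_support_le (n m : ℕ) :
    IsClosed {x : Fin n → ℝ | (Finset.univ.filter fun v => x v ≠ 0).card ≤ m} := by
  have h : {x : Fin n → ℝ | (Finset.univ.filter fun v => x v ≠ 0).card ≤ m} =
      ⋃ s ∈ {s : Finset (Fin n) | s.card ≤ m}, ⋂ v, ⋂ _ : v ∉ s, {x | x v = 0} := by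
    ext x
    simp only [mem_iUnion₂, mem_iInter]
    refine ⟨fun h => ⟨_, h, fun v hv => by simpa using hv⟩, ?_⟩
    rintro ⟨s, hs, h⟩
    refine le_trans (Finset.card_le_card fun v hv => ?_) hs
    by_contra hvs
    exact (Finset.mem_filter.1 hv).2 (h v hvs)
  rw [h]
  exact Set.Finite.isClosed_biUnion (Set.toFinite _) fun s _ => isClosed_iInter fun v =>
    isClosed_iInter fun _ => isClosed_eq (continuous_apply v) continuous_const

theorem isCompact_simplexSkeleton (n k : ℕ) : IsCompact (simplexSkeleton n k) := by
  have h : simplexSkeleton n k = stdSimplex ℝ (Fin n) ∩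
      {x : Fin n → ℝ | (Finset.univ.filter fun v => x v ≠ 0).card ≤ k + 1} := by
    ext x
    exact and_congr_right fun hx => ⟨fun h => h.2, fun h => ⟨hx.2, h⟩⟩
  rw [h]
  exact (isCompact_stdSimplex ℝ (Fin n)).inter_right (isClosed_card_support_le n (k + 1))

instance (n k : ℕ) : CompactSpace (simplexSkeleton n k) :=
  isCompact_iff_compactSpace.1 (isCompact_simplexSkeleton n k)

/-- The tuples of points with pairwise disjoint supports. -/
def disjointTuples (r n k : ℕ) : Set (Fin r → simplexSkeleton n k) :=
  {S | ∀ i j, i ≠ j → ∀ v, (S i).1 v * (S j).1 v = 0}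

theorem isClosed_disjointTuples {r n k : ℕ} : IsClosed (disjointTuples r n k) := by
  have : disjointTuples r n k =
      ⋂ i, ⋂ j, ⋂ _ : i ≠ j, ⋂ v, {S | (S i).1 v * (S j).1 v = 0} := by
    ext; simp [disjointTuples]
  rw [this]
  refine isClosed_iInter fun i => isClosed_iInter fun j => isClosed_iInter fun _ =>
    isClosed_iInter fun v => isClosed_eq ?_ continuous_const
  have h : ∀ i, Continuous fun S : Fin r → simplexSkeleton n k => (S i).1 v := fun i =>
    (continuous_apply v).comp (continuous_subtype_val.comp (continuous_apply i))
  exact (h i).mul (h j)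

theorem injective_of_mem_disjointTuples {r n k : ℕ} {S : Fin r → simplexSkeleton n k}
    (hS : S ∈ disjointTuples r n k) : Function.Injective S := by
  intro i j hij
  by_contra hne
  have h1 := (S i).2.1.2
  have h0 : ∀ v, (S i).1 v = 0 := fun v => by
    have := hS i j hne v
    rw [← hij] at this
    exact mul_self_eq_zero.1 this
  simp [h0] at h1

section

variable {r n k N : ℕ} (G : (Fin n → ℝ) →L[ℝ] (Fin (k + 1) → ℝ) × ℝ × ℝ)

theorem continuous_perturb {Y : Type*} [NormedAddCommGroup Y] [NormedSpace ℝ Y] {N n : ℕ}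
    (G : (Fin n → ℝ) →L[ℝ] Y) (θ : Fin (N * N * n + 1) × Fin N → Y) :
    Continuous (perturb N G θ) := by
  have := fun i => (contDiff_interpFun (N := N) (n := n) i).continuous
  unfold perturb
  fun_prop

/-- The components of a perturbed linear map on the skeleton. -/
noncomputable def skeletonData (r : ℕ)
    (θ : Fin (N * N * n + 1) × Fin N → (Fin (k + 1) → ℝ) × ℝ × ℝ) :
    FibreData r (simplexSkeleton n k) (Fin (k + 1) → ℝ) where
  z := ⟨fun x => (perturb N G θ x).1, by have := continuous_perturb G θ; fun_prop⟩
  t := ⟨fun x => (perturb N G θ x).2.1, by have := continuous_perturb G θ; fun_prop⟩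
  u := ⟨fun x => (perturb N G θ x).2.2, by have := continuous_perturb G θ; fun_prop⟩
  T := disjointTuples r n k

theorem finrank_perturbation_pos (hN : 0 < N) :
    0 < Module.finrank ℝ (Fin (N * N * n + 1) × Fin N → (Fin (k + 1) → ℝ) × ℝ × ℝ) := by
  simp [Module.finrank_pi_fintype, hN]

theorem exists_negligible_slope_unique (hr : 6 ≤ r) (hk : k + 2 = 2 * r) (hn : k + 1 ≤ n)
    (hN : 2 * r ≤ N) :
    ∃ B, Negligible B ∧ ∀ θ ∉ B, ∀ {p S I c h b S' I' c' h' b'},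
      (skeletonData (N := N) G r θ).Level p S I c h b →
      (skeletonData G r θ).Level p S' I' c' h' b' → c = c' := by
  classical
  have hpos := finrank_perturbation_pos (n := n) (k := k) (N := N) (by omega)
  refine ⟨_, .iUnion_of_finrank_pos hpos fun m : Fin (2 * r + 1) =>
    .iUnion_of_finrank_pos hpos fun a : Fin r → Fin m =>
    .iUnion_of_finrank_pos hpos fun a' : Fin r → Fin m =>
    .iUnion_of_finrank_pos hpos fun ha : Function.Injective a =>
    .iUnion_of_finrank_pos hpos fun ha' : Function.Injective a' =>
    .iUnion_of_finrank_pos hpos fun hu : ∀ j, j ∈ range a ∨ j ∈ range a' =>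
    .iUnion_of_finrank_pos hpos fun I : Finset (Fin r) =>
    .iUnion_of_finrank_pos hpos fun I' : Finset (Fin r) =>
    negligible_two_slopes G (k := k) (N := N) (by rw [Fintype.card_fin]; omega) hn ha ha' hu I I'
      rfl (by rw [Fintype.card_fin]; omega), fun θ hθ => ?_⟩
  intro p S I c h b S' I' c' h' b' H H'
  by_contra hc
  refine hθ ?_
  let s : Finset (simplexSkeleton n k) := Finset.univ.image S ∪ Finset.univ.image S'
  let e := s.equivFin
  have hs : s.card < 2 * r + 1 := by
    have h1 := Finset.card_union_le (Finset.univ.image S) (Finset.univ.image S')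
    have h2 := Finset.card_image_le (s := Finset.univ) (f := S)
    have h3 := Finset.card_image_le (s := Finset.univ) (f := S')
    rw [Finset.card_univ, Fintype.card_fin] at h2 h3
    simp only [s]
    omega
  have hmem : ∀ i, S i ∈ s := fun i => by simp [s]
  have hmem' : ∀ i, S' i ∈ s := fun i => by simp [s]
  have hinj := injective_of_mem_disjointTuples H.mem
  have hinj' := injective_of_mem_disjointTuples H'.mem
  simp only [mem_iUnion]
  refine ⟨⟨s.card, hs⟩, fun i => e ⟨S i, hmem i⟩, fun i => e ⟨S' i, hmem' i⟩, ?_, ?_, ?_, I, I',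
    fun j => (e.symm j).1.1, p, c, h, b, c', h', b', ?_, fun j => (e.symm j).1.2.2, hc, ?_, ?_, ?_⟩
  · intro i j hij; exact hinj (by simpa using hij)
  · intro i j hij; exact hinj' (by simpa using hij)
  · intro j
    obtain ⟨y, rfl⟩ := e.surjective j
    rcases Finset.mem_union.1 y.2 with hy | hy
    · obtain ⟨i, -, hi⟩ := Finset.mem_image.1 hy
      exact .inl ⟨i, by simp [hi]⟩
    · obtain ⟨i, -, hi⟩ := Finset.mem_image.1 hy
      exact .inr ⟨i, by simp [hi]⟩
  · exact Subtype.val_injective.comp (Subtype.val_injective.comp e.symm.injective)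
  · intro j
    rcases Finset.mem_union.1 (e.symm j).2 with hy | hy
    · obtain ⟨i, -, hi⟩ := Finset.mem_image.1 hy
      beta_reduce
      rw [← hi]; exact H.fib i
    · obtain ⟨i, -, hi⟩ := Finset.mem_image.1 hy
      beta_reduce
      rw [← hi]; exact H'.fib i
  · intro i
    simpa [skeletonData] using H.eq i
  · intro i
    simpa [skeletonData] using H'.eq i

/-- Adding a point outside of the range. -/
theorem injective_option_elim {X : Type*} {S : Fin r → X} (hS : Function.Injective S) {y : X}
    (hy : y ∉ range S) : Function.Injective fun o : Option (Fin r) => o.elim y S := by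
  rintro (_ | i) (_ | j) h
  · rfl
  · exact absurd ⟨j, h.symm⟩ hy
  · exact absurd ⟨i, h⟩ hy
  · exact congrArg some (hS h)

theorem exists_negligible_extra_level (hr : 6 ≤ r) (hk : k + 2 = 2 * r) (hn : k + 1 ≤ n)
    (hN : 2 * r ≤ N) (δ : ℝ) (b₁ : Bool) :
    ∃ B, Negligible B ∧ ∀ θ ∉ B, ∀ {p S I h b y},
      (skeletonData (N := N) G r θ).Level p S I 0 h b →
      (skeletonData G r θ).z y = p → y ∉ range S →
      (skeletonData G r θ).t y ≠ b - (if b₁ then h else 0) - δ := by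
  classical
  have hpos := finrank_perturbation_pos (n := n) (k := k) (N := N) (by omega)
  refine ⟨_, .iUnion_of_finrank_pos hpos fun I : Finset (Fin r) =>
    negligible_heights G (J := Option (Fin r)) (N := N) (q := 2) (by simp; omega) (fun _ => k)
      (fun _ => hn)
      (fun o => o.elim ![1, if b₁ then -1 else 0] fun j => ![1, if j ∈ I then -1 else 0])
      (fun o => o.elim (-δ) fun _ => 0) ?_, fun θ hθ => ?_⟩
  · simp only [Finset.sum_const, Finset.card_univ, Fintype.card_option, Fintype.card_fin,
      smul_eq_mul]
    nlinarith
  intro p S I h b y H hy hyS ht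
  refine hθ (mem_iUnion.2 ⟨I, fun o => (o.elim y S).1, p, ![b, h],
    Subtype.val_injective.comp
      (injective_option_elim (injective_of_mem_disjointTuples H.mem) hyS),
    fun o => (o.elim y S).2.2, ?_⟩)
  rintro (_ | j)
  · refine ⟨hy, ?_⟩
    simp only [Fin.sum_univ_two, Option.elim]
    refine Eq.trans ht ?_
    cases b₁ <;> simp <;> ring
  · refine ⟨H.fib j, ?_⟩
    simp only [Fin.sum_univ_two, Option.elim]
    have := H.eq j
    change (perturb N G θ (S j)).2.1 + _ + _ = b at this
    rw [zero_mul, add_zero] at this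
    rw [← this]
    split_ifs <;> simp

theorem exists_negligible_extra_zero (hr : 6 ≤ r) (hk : k + 2 = 2 * r) (hn : k + 1 ≤ n)
    (hN : 2 * r ≤ N) :
    ∃ B, Negligible B ∧ ∀ θ ∉ B, ∀ {p S I b y},
      (skeletonData (N := N) G r θ).Level p S I 0 0 b →
      (skeletonData G r θ).z y = p → y ∈ range S := by
  classical
  refine ⟨_,
    negligible_heights G (J := Option (Fin r)) (N := N) (q := 2) (by simp; omega) (fun _ => k)
      (fun _ => hn) (fun o => o.elim ![0, 1] fun j => ![1, 0]) (fun _ => 0) ?_, fun θ hθ => ?_⟩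
  · simp only [Finset.sum_const, Finset.card_univ, Fintype.card_option, Fintype.card_fin,
      smul_eq_mul]
    nlinarith
  intro p S I b y H hy
  by_contra hyS
  refine hθ ⟨fun o => (o.elim y S).1, p, ![b, (skeletonData G r θ).t y],
    Subtype.val_injective.comp
      (injective_option_elim (injective_of_mem_disjointTuples H.mem) hyS),
    fun o => (o.elim y S).2.2, ?_⟩
  rintro (_ | j)
  · exact ⟨hy, by simp [skeletonData]⟩
  · refine ⟨H.fib j, ?_⟩
    have := H.eq j
    simpa [skeletonData] using this

theorem exists_negligible_extra_unique (hr : 6 ≤ r) (hk : k + 2 = 2 * r) (hn : k + 1 ≤ n)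
    (hN : 2 * r ≤ N) :
    ∃ B, Negligible B ∧ ∀ θ ∉ B, ∀ {p S I h b y y'},
      (skeletonData (N := N) G r θ).Level p S I 0 h b →
      (skeletonData G r θ).z y = p → (skeletonData G r θ).z y' = p →
      y ∉ range S → y' ∉ range S → y = y' := by
  classical
  have hpos := finrank_perturbation_pos (n := n) (k := k) (N := N) (by omega)
  refine ⟨_, .iUnion_of_finrank_pos hpos fun I : Finset (Fin r) =>
    negligible_heights G (J := Option (Option (Fin r))) (N := N) (q := 4) (by simp; omega)
      (fun _ => k) (fun _ => hn)
      (fun o => o.elim ![0, 0, 0, 1] fun o => o.elim ![0, 0, 1, 0]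
        fun j => ![1, if j ∈ I then -1 else 0, 0, 0])
      (fun o => 0) ?_, fun θ hθ => ?_⟩
  · simp only [Finset.sum_const, Finset.card_univ, Fintype.card_option, Fintype.card_fin,
      smul_eq_mul]
    nlinarith
  intro p S I h b y y' H hy hy' hyS hyS'
  by_contra hne
  have hinj : Function.Injective fun o : Option (Option (Fin r)) =>
      o.elim y' fun o => o.elim y S := by
    have h1 := injective_option_elim (injective_of_mem_disjointTuples H.mem) hyS
    rintro (_ | i) (_ | j) h
    · rfl
    · rcases j with _ | j
      · exact absurd h.symm hne
      · exact absurd ⟨j, h.symm⟩ hyS'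
    · rcases i with _ | i
      · exact absurd h hne
      · exact absurd ⟨i, h⟩ hyS'
    · exact congrArg some (h1 h)
  refine hθ (mem_iUnion.2 ⟨I, fun o => (o.elim y' fun o => o.elim y S).1, p,
    ![b, h, (skeletonData G r θ).t y, (skeletonData G r θ).t y'],
    Subtype.val_injective.comp hinj, fun o => (o.elim y' fun o => o.elim y S).2.2, ?_⟩)
  rintro (_ | _ | j)
  · refine ⟨hy', ?_⟩
    simp [skeletonData, Fin.sum_univ_four]
  · refine ⟨hy, ?_⟩
    simp [skeletonData, Fin.sum_univ_four]
  · refine ⟨H.fib j, ?_⟩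
    simp only [Fin.sum_univ_four, Option.elim]
    have := H.eq j
    change (perturb N G θ (S j)).2.1 + _ + _ = b at this
    rw [zero_mul, add_zero] at this
    rw [← this]
    split_ifs <;> simp

theorem exists_negligible_zero_u_inj (hk : k + 2 = 2 * r) (hn : k + 1 ≤ n)
    (hN : 2 * r ≤ N) :
    ∃ B, Negligible B ∧ ∀ θ ∉ B, ∀ {p S I b},
      (skeletonData (N := N) G r θ).Level p S I 0 0 b →
      Function.Injective ((skeletonData G r θ).u ∘ S) := by
  classical
  have hpos := finrank_perturbation_pos (n := n) (k := k) (N := N) (by omega)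
  refine ⟨_, .iUnion_of_finrank_pos hpos fun i : Fin r =>
    .iUnion_of_finrank_pos hpos fun i' : Fin r =>
    .iUnion_of_finrank_pos hpos fun hne : i ≠ i' =>
    negligible_equal_slopes G (N := N) (J := Fin r) (by simp; omega) hn hne ?_, fun θ hθ => ?_⟩
  · simp only [Fintype.card_fin]
    nlinarith
  intro p S I b H i i' hii
  by_contra hne
  simp only [mem_iUnion, not_exists] at hθ
  refine hθ i i' hne ⟨fun j => (S j).1, p, b, Subtype.val_injective.comp
    (injective_of_mem_disjointTuples H.mem), fun j => (S j).2.2, fun j => ⟨H.fib j, ?_⟩, hii⟩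
  simpa [skeletonData] using H.eq j

theorem exists_negligible_zero_support (hr : 6 ≤ r) (hk : k + 2 = 2 * r) (hn : k + 1 ≤ n)
    (hN : 2 * r ≤ N) :
    ∃ B, Negligible B ∧ ∀ θ ∉ B, ∀ {p S I b},
      (skeletonData (N := N) G r θ).Level p S I 0 0 b →
      ∀ j, k + 1 ≤ (Finset.univ.filter fun v => (S j).1 v ≠ 0).card := by
  classical
  have hpos := finrank_perturbation_pos (n := n) (k := k) (N := N) (by omega)
  refine ⟨_, .iUnion_of_finrank_pos hpos fun i : Fin r =>
    negligible_heights G (N := N) (J := Fin r) (q := 1) (by simp; omega)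
      (Function.update (fun _ => k) i (k - 1)) ?_ (fun _ _ => 1) (fun _ => 0) ?_, fun θ hθ => ?_⟩
  · intro j
    rcases eq_or_ne j i with rfl | hj
    · simp; omega
    · simpa [hj] using hn
  · rw [Finset.sum_update_of_mem (Finset.mem_univ i), Finset.sum_const,
      Finset.card_sdiff_of_subset (by simp)]
    simp only [Finset.card_univ, Fintype.card_fin, smul_eq_mul, Finset.card_singleton]
    obtain ⟨m, rfl⟩ : ∃ m, r = m + 1 := ⟨r - 1, by omega⟩
    rw [Nat.add_sub_cancel]
    have : k - 1 + 1 = k := by omega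
    nlinarith
  intro p S I b H i
  by_contra! hlt
  simp only [mem_iUnion, not_exists] at hθ
  refine hθ i ⟨fun j => (S j).1, p, fun _ => b, Subtype.val_injective.comp
    (injective_of_mem_disjointTuples H.mem), fun j => ?_, fun j => ⟨H.fib j, ?_⟩⟩
  · rcases eq_or_ne j i with rfl | hj
    · rw [Function.update_self]
      exact ⟨(S j).2.2.1, by beta_reduce; omega⟩
    · rw [Function.update_of_ne hj]
      exact (S j).2.2
  · simpa [skeletonData] using H.eq j

end

/-- The moment map on barycentric coordinates. -/
noncomputable def momentMap (n M : ℕ) : (Fin n → ℝ) →L[ℝ] (Fin M → ℝ) :=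
  LinearMap.toContinuousLinearMap
    { toFun := fun x i => ∑ v, x v * ((v : ℕ) : ℝ) ^ (i : ℕ)
      map_add' := fun x y => by ext i; simp [add_mul, Finset.sum_add_distrib]
      map_smul' := fun c x => by ext i; simp [Finset.mul_sum, mul_assoc] }

theorem eq_zero_of_momentMap_eq_zero {n M : ℕ} {x : Fin n → ℝ}
    (hx : (Finset.univ.filter fun v => x v ≠ 0).card ≤ M) (h0 : momentMap n M x = 0) : x = 0 := by
  set s := Finset.univ.filter fun v => x v ≠ 0
  let e := s.equivFin
  have h1 : (fun j => x (e.symm j)) = 0 := by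
    refine Matrix.eq_zero_of_forall_pow_sum_mul_pow_eq_zero
      (f := fun j => (((e.symm j : Fin n) : ℕ) : ℝ)) ?_ fun i => ?_
    · exact Nat.cast_injective.comp (Fin.val_injective.comp
        (Subtype.val_injective.comp e.symm.injective))
    · have h2 := congrFun h0 ⟨i, i.2.trans_le hx⟩
      change ∑ v, x v * ((v : ℕ) : ℝ) ^ (i : ℕ) = 0 at h2
      rw [e.symm.sum_comp fun v : s => x v * ((v : ℕ) : ℝ) ^ (i : ℕ),
        Finset.sum_coe_sort s fun v => x v * ((v : ℕ) : ℝ) ^ (i : ℕ), ← h2]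
      refine Finset.sum_subset (Finset.subset_univ s) fun v _ hv => ?_
      have : x v = 0 := by simpa [s] using hv
      rw [this, zero_mul]
  ext v
  by_contra hv
  have hs : v ∈ s := by simp only [s, Finset.mem_filter]; exact ⟨Finset.mem_univ _, hv⟩
  exact hv (by simpa using congrFun h1 (e ⟨v, hs⟩))

theorem exists_le_norm_momentMap (n M : ℕ) : ∃ c : ℝ, 0 < c ∧ ∀ x : Fin n → ℝ,
    (Finset.univ.filter fun v => x v ≠ 0).card ≤ M → c * ‖x‖ ≤ ‖momentMap n M x‖ := by
  obtain ⟨c, hc, h⟩ := ((isCompact_sphere (0 : Fin n → ℝ) 1).inter_right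
    (isClosed_card_support_le n M)).exists_forall_le' (f := fun x => ‖momentMap n M x‖) (a := 0)
    (by fun_prop) fun x hx => norm_pos_iff.2 fun h0 => by
      have := eq_zero_of_momentMap_eq_zero hx.2 h0
      simpa [this] using hx.1
  refine ⟨c, hc, fun x hx => ?_⟩
  rcases eq_or_ne x 0 with rfl | hne
  · simp
  have hpos : 0 < ‖x‖ := norm_pos_iff.2 hne
  have := h (‖x‖⁻¹ • x) ⟨by simp [norm_smul, hpos.ne'], ?_⟩
  · rw [map_smul, norm_smul, norm_inv, norm_norm, inv_mul_eq_div, le_div_iff₀ hpos] at this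
    exact this
  · refine le_trans (Finset.card_le_card fun v hv => ?_) hx
    simp only [Finset.mem_filter, Finset.mem_univ, true_and] at hv ⊢
    intro h0
    simp [h0] at hv

/-- Small perturbations of the moment map remain injective in general position. -/
theorem exists_perturb_injective (N n M : ℕ) : ∃ ε : ℝ, 0 < ε ∧
    ∀ θ : Fin (N * N * n + 1) × Fin N → (Fin M → ℝ) × ℝ × ℝ, ‖θ‖ < ε →
      ∀ x ∈ stdSimplex ℝ (Fin n), ∀ y ∈ stdSimplex ℝ (Fin n),
        (Finset.univ.filter fun v => x v ≠ y v).card ≤ M →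
        (perturb N ((momentMap n M).prod 0) θ x).1 = (perturb N ((momentMap n M).prod 0) θ y).1 →
        x = y := by
  obtain ⟨c, hc, hmom⟩ := exists_le_norm_momentMap n M
  have hlip : ∀ i : Fin (N * N * n + 1) × Fin N, ∃ C,
      LipschitzOnWith C (interpFun N n i) (stdSimplex ℝ (Fin n)) := fun i =>
    LocallyLipschitzOn.exists_lipschitzOnWith_of_compact (isCompact_stdSimplex ℝ (Fin n))
      ((contDiff_interpFun i).locallyLipschitz).locallyLipschitzOn
  choose C hC using hlip
  have hsum : 0 ≤ ∑ i, (C i : ℝ) := Finset.sum_nonneg fun i _ => (C i).2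
  refine ⟨c / (1 + ∑ i, (C i : ℝ)), by positivity, fun θ hθ x hx y hy hcard hxy => ?_⟩
  by_contra hne
  have hpos : 0 < ‖x - y‖ := norm_pos_iff.2 (sub_ne_zero.2 hne)
  have h1 := hmom (x - y) (by simpa [sub_eq_zero] using hcard)
  have h2 : momentMap n M (x - y) = -∑ i, (interpFun N n i x - interpFun N n i y) • (θ i).1 := by
    simp only [perturb, Prod.fst_add, ContinuousLinearMap.prod_apply, Prod.fst_sum,
      Prod.smul_fst] at hxy
    simp only [sub_smul, Finset.sum_sub_distrib, map_sub]
    rw [neg_sub, sub_eq_sub_iff_add_eq_add, hxy]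
    abel
  have h3 : ‖momentMap n M (x - y)‖ ≤ ∑ i, C i * ‖x - y‖ * ‖θ‖ := by
    rw [h2, norm_neg]
    refine norm_sum_le_of_le _ fun i _ => ?_
    rw [norm_smul]
    gcongr
    · simpa [dist_eq_norm] using (hC i).dist_le_mul x hx y hy
    · exact (norm_fst_le _).trans (norm_le_pi_norm θ i)
  rw [← Finset.sum_mul, ← Finset.sum_mul] at h3
  rw [lt_div_iff₀ (by positivity)] at hθ
  nlinarith [norm_nonneg θ]

/-- Data on the skeleton of a simplex in general position. -/
theorem exists_generic_skeletonData {r n k : ℕ} (hr : 6 ≤ r) (hk : k + 2 = 2 * r)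
    (hn : k + 1 ≤ n) : ∃ D : FibreData r (simplexSkeleton n k) (Fin (k + 1) → ℝ),
      D.Generic ∧ D.T = disjointTuples r n k := by
  classical
  let N := 2 * r
  let G : (Fin n → ℝ) →L[ℝ] (Fin (k + 1) → ℝ) × ℝ × ℝ := (momentMap n (k + 1)).prod 0
  obtain ⟨ε, hε, hinj⟩ := exists_perturb_injective N n (k + 1)
  obtain ⟨B₁, hB₁, h₁⟩ := exists_negligible_slope_unique G hr hk hn (N := N) le_rfl
  choose B₂ hB₂ h₂ using fun δ b₁ =>
    exists_negligible_extra_level G hr hk hn (N := N) le_rfl δ b₁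
  obtain ⟨B₃, hB₃, h₃⟩ := exists_negligible_extra_zero G hr hk hn (N := N) le_rfl
  obtain ⟨B₄, hB₄, h₄⟩ := exists_negligible_extra_unique G hr hk hn (N := N) le_rfl
  obtain ⟨B₅, hB₅, h₅⟩ := exists_negligible_zero_u_inj G hk hn (N := N) le_rfl
  obtain ⟨B₆, hB₆, h₆⟩ := exists_negligible_zero_support G hr hk hn (N := N) le_rfl
  have hB₂' : Negligible (⋃ m : ℕ, B₂ (1 / ((m : ℝ) + 1)) false) := .iUnion fun m => hB₂ _ _
  obtain ⟨θ, hθε, hθ⟩ := (((((((hB₁.union (hB₂ 0 false)).union (hB₂ 0 true)).union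
    hB₂').union hB₃).union hB₄).union hB₅).union hB₆).dense_compl.exists_dist_lt 0 hε |>.imp
      fun _ h => h.symm
  rw [dist_zero_left] at hθε
  simp only [compl_union, mem_inter_iff, mem_compl_iff, mem_iUnion, not_exists] at hθ
  obtain ⟨⟨⟨⟨⟨⟨⟨k₁, k₂⟩, k₃⟩, k₄⟩, k₅⟩, k₆⟩, k₇⟩, k₈⟩ := hθ
  refine ⟨skeletonData G r θ, ?_, rfl⟩
  constructor
  · omega
  · exact isClosed_disjointTuples
  · intro S hS σ i j hij
    exact hS _ _ (σ.injective.ne hij)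
  · exact fun S => injective_of_mem_disjointTuples
  · exact h₁ θ k₁
  · intro p S I h b y H hy hyS
    refine ⟨?_, ?_, fun m => ?_⟩
    · simpa using h₂ 0 false θ k₂ H hy hyS
    · simpa using h₂ 0 true θ k₃ H hy hyS
    · simpa using h₂ _ false θ (k₄ m) H hy hyS
  · exact h₃ θ k₅
  · exact h₄ θ k₆
  · intro p S I b H j hj
    have hU : {y : simplexSkeleton n k | ∀ v, (S j).1 v ≠ 0 → y.1 v ≠ 0} ∈ 𝓝 (S j) := by
      have : {y : simplexSkeleton n k | ∀ v, (S j).1 v ≠ 0 → y.1 v ≠ 0} =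
          ⋂ v, ⋂ _ : (S j).1 v ≠ 0, {y | y.1 v ≠ 0} := by ext; simp
      rw [this, Filter.iInter_mem]
      intro v
      rw [Filter.iInter_mem]
      intro hv
      exact ((continuous_apply v).comp continuous_subtype_val).continuousAt.eventually_ne hv
    obtain ⟨⟨x, y⟩, ⟨hx, hy⟩, hne, hxy⟩ := mem_closure_iff_nhds.1 hj _ (prod_mem_nhds hU hU)
    have key : ∀ w : simplexSkeleton n k, (∀ v, (S j).1 v ≠ 0 → w.1 v ≠ 0) →
        (Finset.univ.filter fun v => (S j).1 v ≠ 0) = Finset.univ.filter fun v => w.1 v ≠ 0 :=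
      fun w hw => Finset.eq_of_subset_of_card_le
        (Finset.monotone_filter_right _ fun v _ hv => hw v hv) (w.2.2.2.trans (h₆ θ k₈ H j))
    refine hne (Subtype.ext (hinj θ hθε x x.2.1 y y.2.1
      (le_trans (Finset.card_le_card fun v hv => ?_) (S j).2.2.2) hxy))
    have hv' := (Finset.mem_filter.1 hv).2
    by_contra hS
    have hx0 : x.1 v = 0 := by
      rw [key x hx] at hS; simpa using hS
    have hy0 : y.1 v = 0 := by
      rw [key y hy] at hS; simpa using hS
    exact hv' (hx0.trans hy0.symm)
  · exact h₅ θ k₇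

theorem six_le_of_not_prime_power {r : ℕ} (hr : 2 ≤ r)
    (hnp : ¬ ∃ q m : ℕ, Nat.Prime q ∧ 1 ≤ m ∧ r = q ^ m) : 6 ≤ r := by
  by_contra! h
  refine hnp ?_
  interval_cases r
  · exact ⟨2, 1, by norm_num⟩
  · exact ⟨3, 1, by norm_num⟩
  · exact ⟨2, 2, by norm_num⟩
  · exact ⟨5, 1, by norm_num⟩

/-- If `r` is not a prime power, then the `(2 * r - 2)`-skeleton of a simplex has a map to
`ℝ ^ (2 * r)` without `r`-fold coincidences of points with disjoint supports. -/
theorem exists_map_skeleton {r n k : ℕ} (hr : 2 ≤ r)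
    (hnp : ¬ ∃ q m : ℕ, Nat.Prime q ∧ 1 ≤ m ∧ r = q ^ m) (hk : k + 2 = 2 * r)
    (hn : k + 1 ≤ n) : ∃ F : C(Fin n → ℝ, (Fin (k + 1) → ℝ) × ℝ),
      ∀ S ∈ disjointTuples r n k, ∀ q, ¬ ∀ s, F (S s) = q := by
  obtain ⟨D, hD, hT⟩ := exists_generic_skeletonData (six_le_of_not_prime_power hr hnp) hk hn
  obtain ⟨m, hm, hsum⟩ := exists_weights hr hnp
  obtain ⟨X⟩ := exists_slotSystem m hm hsum
  obtain ⟨t, ht⟩ := hD.exists_nonconstant (X.raisingPattern hr)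
  obtain ⟨F, hF⟩ := ContinuousMap.exists_restrict_eq (isCompact_simplexSkeleton n k).isClosed
    (D.z.prodMk t)
  have hF' : ∀ x : simplexSkeleton n k, F x = (D.z x, t x) := fun x => DFunLike.congr_fun hF x
  refine ⟨F, fun S hS q hq => ht S (hT ▸ hS) q.1 (fun j => ?_) q.2 fun j => ?_⟩
  · rw [← hq j, hF']
  · rw [← hq j, hF']

/-- The elementary symmetric polynomial of degree `m`. -/
noncomputable def symmSum {n : ℕ} (m : ℕ) (y : Fin n → ℝ) : ℝ :=
  ∑ A ∈ Finset.univ.powersetCard m, ∏ v ∈ A, y v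

theorem symmSum_eq_zero_iff {n m : ℕ} {y : Fin n → ℝ} (hy : ∀ v, 0 ≤ y v) :
    symmSum m y = 0 ↔ (Finset.univ.filter fun v => y v ≠ 0).card < m := by
  rw [symmSum, Finset.sum_eq_zero_iff_of_nonneg fun A _ => Finset.prod_nonneg fun v _ => hy v]
  constructor
  · intro h
    by_contra! hc
    obtain ⟨A, hA, hAm⟩ := Finset.exists_subset_card_eq hc
    refine Finset.prod_ne_zero_iff.2 (fun v hv => ?_)
      (h A (Finset.mem_powersetCard.2 ⟨Finset.subset_univ _, hAm⟩))
    exact (Finset.mem_filter.1 (hA hv)).2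
  · intro h A hA
    by_contra hne
    refine absurd (Finset.card_le_card fun v hv => ?_)
      (not_le.2 (h.trans_eq (Finset.mem_powersetCard.1 hA).2.symm))
    simpa using Finset.prod_ne_zero_iff.1 hne v hv

theorem exists_card_support_lt {r n m : ℕ} (hn : n < r * m) {y : Fin r → Fin n → ℝ}
    (hy : ∀ s t, s ≠ t → ∀ v, y s v * y t v = 0) :
    ∃ s, (Finset.univ.filter fun v => y s v ≠ 0).card < m := by
  by_contra! h
  have h1 := Finset.card_biUnion (s := Finset.univ)
    (t := fun s => Finset.univ.filter fun v => y s v ≠ 0) (by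
      intro s _ t _ hst
      refine Finset.disjoint_left.2 fun v hv hv' => ?_
      simp only [Finset.mem_filter, Finset.mem_univ, true_and] at hv hv'
      exact mul_ne_zero hv hv' (hy s t hst v))
  have h2 := Finset.card_le_univ
    (Finset.univ.biUnion fun s => Finset.univ.filter fun v => y s v ≠ 0)
  have h3 := Finset.sum_le_sum fun s (_ : s ∈ Finset.univ) => h s
  rw [← h1, Finset.sum_const, Finset.card_univ, Fintype.card_fin, smul_eq_mul] at h3
  rw [Fintype.card_fin] at h2
  omega

theorem exists_almost_embedding {r n k : ℕ} (e : ℕ) (hr : 2 ≤ r)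
    (hnp : ¬ ∃ q m : ℕ, Nat.Prime q ∧ 1 ≤ m ∧ r = q ^ m) (hk : k + 2 = 2 * r)
    (hn : k + 1 ≤ n) (hn' : n < r * (2 * r)) :
    ∃ f : C(Fin n ⊕ Fin e × Fin (r - 1) → ℝ, ((Fin (k + 1) → ℝ) × ℝ) × ℝ × (Fin e → ℝ)),
      ∀ x : Fin r → Fin n ⊕ Fin e × Fin (r - 1) → ℝ, (∀ s, x s ∈ stdSimplex ℝ _) →
        (∀ s t, s ≠ t → ∀ v, x s v * x t v = 0) → ∀ q, ¬ ∀ s, f (x s) = q := by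
  obtain ⟨F, hF⟩ := exists_map_skeleton hr hnp hk hn
  refine ⟨⟨fun x => (F fun v => x (.inl v), symmSum (2 * r) fun v => x (.inl v),
    fun b => ∑ i, x (.inr (b, i))), by unfold symmSum; fun_prop⟩, fun x hx hdisj q hq => ?_⟩
  simp only [ContinuousMap.coe_mk] at hq
  have hblock : ∀ s b i, x s (.inr (b, i)) = 0 := by
    intro s b
    have h0 : ∃ s', ∑ i, x s' (.inr (b, i)) = 0 := by
      by_contra! hc
      choose i _ hi using fun s' => Finset.exists_ne_zero_of_sum_ne_zero (hc s')
      have hinj : Function.Injective i := by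
        intro s' t h
        by_contra hne
        refine mul_ne_zero (hi s') ?_ (hdisj s' t hne _)
        rw [h]
        exact hi t
      have := Fintype.card_le_of_injective i hinj
      simp only [Fintype.card_fin] at this
      omega
    obtain ⟨s', hs'⟩ := h0
    have h1 : ∑ i, x s (.inr (b, i)) = 0 := by
      rw [← hs']
      exact congrFun (congrArg (fun w => w.2.2) ((hq s).trans (hq s').symm)) b
    intro i
    exact (Finset.sum_eq_zero_iff_of_nonneg fun i _ => (hx s).1 _).1 h1 i (Finset.mem_univ i)
  have hsupp : ∀ s, (Finset.univ.filter fun v => x s (.inl v) ≠ 0).card < 2 * r := by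
    obtain ⟨s', hs'⟩ := exists_card_support_lt hn' (y := fun s v => x s (.inl v))
      fun s t hst v => hdisj s t hst _
    rw [← symmSum_eq_zero_iff fun v => (hx s').1 _] at hs'
    intro s
    rw [← symmSum_eq_zero_iff fun v => (hx s).1 _, ← hs']
    exact congrArg (fun w => w.2.1) ((hq s).trans (hq s').symm)
  have hsum : ∀ s, ∑ v, x s (.inl v) = 1 := fun s => by
    rw [← (hx s).2, Fintype.sum_sum_type, Fintype.sum_prod_type]
    simp [hblock]
  refine hF (fun s => ⟨fun v => x s (.inl v), ⟨fun v => (hx s).1 _, hsum s⟩, hsum s, ?_⟩)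
    (fun s t hst v => hdisj s t hst _) q.1 fun s => congrArg Prod.fst (hq s)
  have := hsupp s
  beta_reduce
  omega

theorem stmt_16 (r d : ℕ) (hr2 : 2 ≤ r)
    (hnp : ¬ ∃ q m : ℕ, Nat.Prime q ∧ 1 ≤ m ∧ r = q ^ m)
    (hd : 2 * r + 1 ≤ d) :
    ∃ f : (Fin ((d + 1) * (r - 1) + 1) → ℝ) → EuclideanSpace ℝ (Fin d),
      ContinuousOn f (stdSimplex ℝ (Fin ((d + 1) * (r - 1) + 1))) ∧
      ∀ A : Fin r → Set (Fin ((d + 1) * (r - 1) + 1)),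
        (∀ s t : Fin r, s ≠ t → Disjoint (A s) (A t)) →
        (⋂ s : Fin r,
          f '' {x ∈ stdSimplex ℝ (Fin ((d + 1) * (r - 1) + 1)) |
            ∀ i ∉ A s, x i = 0}) = ∅ := by
  obtain ⟨e, rfl⟩ := Nat.exists_eq_add_of_le hd
  obtain ⟨k, hk⟩ : ∃ k, k + 2 = 2 * r := ⟨2 * r - 2, by omega⟩
  obtain ⟨n, hn⟩ : ∃ n, n + 1 = r * (2 * r) := Nat.exists_add_one_eq.2 (by positivity)
  obtain ⟨f, hf⟩ := exists_almost_embedding e hr2 hnp hk (n := n) (by nlinarith) (by omega)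
  let σ : Fin n ⊕ Fin e × Fin (r - 1) ≃ Fin ((2 * r + 1 + e + 1) * (r - 1) + 1) :=
    Fintype.equivOfCardEq (by
      simp only [Fintype.card_sum, Fintype.card_prod, Fintype.card_fin]
      obtain ⟨m, rfl⟩ : ∃ m, r = m + 1 := ⟨r - 1, by omega⟩
      rw [Nat.add_sub_cancel]
      nlinarith)
  let L : (((Fin (k + 1) → ℝ) × ℝ) × ℝ × (Fin e → ℝ)) ≃L[ℝ]
      EuclideanSpace ℝ (Fin (2 * r + 1 + e)) :=
    ContinuousLinearEquiv.ofFinrankEq (by simp; omega)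
  refine ⟨fun x => L (f (x ∘ σ)), Continuous.continuousOn (by fun_prop), fun A hA => ?_⟩
  refine eq_empty_of_forall_notMem fun q hq => ?_
  choose x hx hxq using mem_iInter.1 hq
  refine hf (fun s => x s ∘ σ) (fun s => ⟨fun v => (hx s).1.1 _, ?_⟩) (fun s t hst v => ?_)
    (L.symm q) fun s => ?_
  · exact (σ.sum_comp (x s)).trans (hx s).1.2
  · by_cases hv : σ v ∈ A s
    · have : x t (σ v) = 0 := (hx t).2 _ (disjoint_left.1 (hA s t hst) hv)
      simp [this]
    · simp [(hx s).2 _ hv]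
  · rw [← hxq s, L.symm_apply_apply]
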